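/- arXiv:2605.31496 — 2 statements merged into one kernel-verified Lean document; each statement's English description precedes it below -/
import Mathlib

section
/- Let n ≥ 1 and d ≥ 1 be integers, let r be an integer with r ≥ 45nd², let â_j := j/r for 0 ≤ j ≤ r and â_j := 1 for j > r, and let N := ⌈3·log₂ r⌉. Let α ∈ ℕ^n with α_i ≤ d for all i ∈ {1,…,n}, and for each k ∈ ℕ let Q_k be the univariate real polynomial with Q_k(x) = ∫_{−1}^{1} T_k(y)·S_r^{(â)}(x,y)² dμ(y) for all x ∈ ℝ. Then the n-variate polynomial x ↦ ∏_{i=1}^n p_{r,N}^{(â)}(x_i)·Q_{α_i}(x_i) satisfies ‖∏_{i=1}^n p_{r,N}^{(â)}(x_i)·Q_{α_i}(x_i) − ∏_{i=1}^n T_{α_i}(x_i)‖_{1,cheb} ≤ e·n·(45d²·(log₂ r + 1) + 4)/r², where e is Euler's number. -/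
open Polynomial MeasureTheory

/-- The k-th Chebyshev polynomial of the first kind over ℝ. -/
noncomputable def chebT (k : ℕ) : Polynomial ℝ := Polynomial.Chebyshev.T ℝ (k : ℤ)

/-- The Chebyshev probability measure on `[-1,1]`, `dμ(y) = dy/(π √(1-y²))`. -/
noncomputable def chebMeasure : Measure ℝ :=
  (volume.restrict (Set.Icc (-1 : ℝ) 1)).withDensity
    (fun y => ENNReal.ofReal (1 / (Real.pi * Real.sqrt (1 - y ^ 2))))

/-- The kernel `S_r^{(a)}(x,y) = 1 + 2∑_{j=1}^r (1-a_j) T_j(x) T_j(y)`. -/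
noncomputable def Sker (r : ℕ) (a : ℕ → ℝ) (x y : ℝ) : ℝ :=
  1 + 2 * ∑ j ∈ Finset.Icc 1 r, (1 - a j) * (chebT j).eval x * (chebT j).eval y

/-- `M_r^{(a)}` as a polynomial, `M_r^{(a)} = 1 + 2∑_{j=1}^r (1-a_j)² T_j²`. -/
noncomputable def MPoly (r : ℕ) (a : ℕ → ℝ) : Polynomial ℝ :=
  1 + Polynomial.C 2 * ∑ j ∈ Finset.Icc 1 r, Polynomial.C ((1 - a j) ^ 2) * (chebT j) ^ 2

/-- `C = 1 + 2∑_{j=1}^r (1-a_j)²`. -/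
noncomputable def Cval (r : ℕ) (a : ℕ → ℝ) : ℝ := 1 + 2 * ∑ j ∈ Finset.Icc 1 r, (1 - a j) ^ 2

/-- The polynomial `p_{r,N}^{(a)} = (1/C) ∑_{m=0}^{N} (1 - M_r^{(a)}/C)^m`. -/
noncomputable def pPoly (r : ℕ) (a : ℕ → ℝ) (N : ℕ) : Polynomial ℝ :=
  Polynomial.C (1 / Cval r a) *
    ∑ m ∈ Finset.range (N + 1), ((1 : Polynomial ℝ) - Polynomial.C (1 / Cval r a) * MPoly r a) ^ m

/-- The Fejér weights `â_j = j/r` for `j ≤ r` and `â_j = 1` for `j > r`. -/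
noncomputable def fejerWeights (r : ℕ) : ℕ → ℝ := fun j => if j ≤ r then (j : ℝ) / r else 1

/-- The multivariate (tensor) Chebyshev polynomial `T_α(x) = ∏ᵢ T_{αᵢ}(xᵢ)`. -/
noncomputable def mvChebT (n : ℕ) (α : Fin n → ℕ) : MvPolynomial (Fin n) ℝ :=
  ∏ i, Polynomial.aeval (MvPolynomial.X i) (chebT (α i))

/-- The Chebyshev 1-norm of an n-variate real polynomial: the sum of the absolute values
of the coefficients in the (unique) expansion in the tensor Chebyshev basis. -/
noncomputable def mvCheb1Norm {n : ℕ} (p : MvPolynomial (Fin n) ℝ) : ℝ :=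
  sInf {s : ℝ | ∃ c : (Fin n → ℕ) →₀ ℝ,
    p = c.sum (fun α coef => MvPolynomial.C coef * mvChebT n α) ∧
    s = c.sum (fun _ coef => |coef|)}

/-- `AbsComb B p s` says that `p` is a finite real linear combination of elements of `B` whose
coefficients have absolute values summing to at most `s`. -/
inductive AbsComb {A : Type*} [CommRing A] [Algebra ℝ A] (B : Set A) : A → ℝ → Prop
  | zero {s : ℝ} (hs : 0 ≤ s) : AbsComb B 0 s
  | smul_add {p b : A} {s t c : ℝ} (hb : b ∈ B) (hp : AbsComb B p s) (h : |c| + s ≤ t) :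
      AbsComb B (c • b + p) t

namespace AbsComb

variable {A A' : Type*} [CommRing A] [Algebra ℝ A] [CommRing A'] [Algebra ℝ A']
  {B B' : Set A} {p q : A} {s t : ℝ}

theorem nonneg (h : AbsComb B p s) : 0 ≤ s := by
  induction h with
  | zero hs => exact hs
  | smul_add _ _ h ih => exact (add_nonneg (abs_nonneg _) ih).trans h

theorem mono (h : AbsComb B p s) (hst : s ≤ t) : AbsComb B p t := by
  cases h with
  | zero hs => exact zero (hs.trans hst)
  | smul_add hb hp h => exact smul_add hb hp (h.trans hst)

theorem of_mem (h : p ∈ B) : AbsComb B p 1 := by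
  simpa using smul_add (c := 1) h (zero le_rfl) (by simp)

theorem add (hp : AbsComb B p s) (hq : AbsComb B q t) : AbsComb B (p + q) (s + t) := by
  induction hp with
  | zero hs => simpa using hq.mono (by linarith)
  | smul_add hb _ h ih => rw [add_assoc]; exact smul_add hb ih (by linarith)

theorem smul (c : ℝ) (hp : AbsComb B p s) : AbsComb B (c • p) (|c| * s) := by
  induction hp with
  | zero hs => simpa using zero (by positivity)
  | smul_add hb _ h ih =>
    rw [_root_.smul_add, smul_smul]
    refine smul_add hb ih ?_
    rw [abs_mul, ← mul_add]
    gcongr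

theorem neg (hp : AbsComb B p s) : AbsComb B (-p) s := by
  simpa using hp.smul (-1)

theorem sub (hp : AbsComb B p s) (hq : AbsComb B q t) : AbsComb B (p - q) (s + t) :=
  sub_eq_add_neg p q ▸ hp.add hq.neg

theorem sum {ι : Type*} (I : Finset ι) {f : ι → A} {g : ι → ℝ}
    (h : ∀ i ∈ I, AbsComb B (f i) (g i)) : AbsComb B (∑ i ∈ I, f i) (∑ i ∈ I, g i) := by
  classical
  induction I using Finset.induction_on with
  | empty => simpa using zero le_rfl
  | insert a I ha ih =>
    rw [Finset.sum_insert ha, Finset.sum_insert ha]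
    exact (h a (by simp)).add (ih fun i hi => h i (by simp [hi]))

theorem mul (hB : ∀ b ∈ B, ∀ b' ∈ B', AbsComb B (b * b') 1)
    (hp : AbsComb B p s) (hq : AbsComb B' q t) : AbsComb B (p * q) (s * t) := by
  have key : ∀ b ∈ B, AbsComb B (b * q) t := by
    intro b hb
    induction hq with
    | zero hs => simpa using zero hs
    | smul_add hb' _ h ih =>
      rw [mul_add, mul_smul_comm]
      exact (((hB b hb _ hb').smul _).add ih).mono (by simpa using h)
  have ht := hq.nonneg
  induction hp with
  | zero hs => simpa using zero (mul_nonneg hs ht)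
  | smul_add hb _ h ih =>
    rw [add_mul, smul_mul_assoc]
    refine (((key _ hb).smul _).add ih).mono ?_
    rw [← add_mul]
    gcongr

theorem pow (hB : ∀ b ∈ B, ∀ b' ∈ B, AbsComb B (b * b') 1) (h1 : (1 : A) ∈ B)
    (hp : AbsComb B p s) (m : ℕ) : AbsComb B (p ^ m) (s ^ m) := by
  induction m with
  | zero => simpa using of_mem h1
  | succ m ih => rw [pow_succ, pow_succ]; exact ih.mul hB hp

theorem map (f : A →ₐ[ℝ] A') (hp : AbsComb B p s) : AbsComb (f '' B) (f p) s := by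
  induction hp with
  | zero hs => simpa using zero hs
  | smul_add hb _ h ih =>
    rw [map_add, map_smul]
    exact smul_add (Set.mem_image_of_mem _ hb) ih h

end AbsComb

open Polynomial.Chebyshev in
theorem chebT_natAbs (k : ℤ) : chebT k.natAbs = T ℝ k := T_natAbs ℝ k

namespace Polynomial.Chebyshev

theorem T_mul_T_eq (i j : ℤ) :
    T ℝ i * T ℝ j = (1 / 2 : ℝ) • T ℝ (i + j) + (1 / 2 : ℝ) • T ℝ (i - j) := by
  rw [← smul_add, ← T_mul_T, mul_assoc, ← C_ofNat, ← smul_eq_C_mul, smul_smul]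
  norm_num

theorem absComb_T_mul_T (i j : ℤ) : AbsComb (Set.range (T ℝ)) (T ℝ i * T ℝ j) 1 := by
  rw [T_mul_T_eq]
  exact (((AbsComb.of_mem (Set.mem_range_self _)).smul _).add
    ((AbsComb.of_mem (Set.mem_range_self _)).smul _)).mono (by norm_num)

theorem absComb_mul_of_mem_range_T :
    ∀ b ∈ Set.range (T ℝ), ∀ b' ∈ Set.range (T ℝ), AbsComb (Set.range (T ℝ)) (b * b') 1 := by
  rintro _ ⟨i, rfl⟩ _ ⟨j, rfl⟩
  exact absComb_T_mul_T i j

theorem one_mem_range_T : (1 : ℝ[X]) ∈ Set.range (T ℝ) := ⟨0, T_zero ℝ⟩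

end Polynomial.Chebyshev

open Polynomial.Chebyshev in
theorem mvChebT_update {n : ℕ} (α : Fin n → ℕ) (i : Fin n) (k : ℤ) :
    mvChebT n (Function.update α i k.natAbs) =
      aeval (MvPolynomial.X i) (T ℝ k) *
        ∏ j ∈ Finset.univ.erase i, aeval (MvPolynomial.X j) (chebT (α j)) := by
  rw [mvChebT, ← Finset.mul_prod_erase _ _ (Finset.mem_univ i), Function.update_self,
    chebT_natAbs]
  congr 1
  refine Finset.prod_congr rfl fun j hj => ?_
  rw [Function.update_of_ne (Finset.ne_of_mem_erase hj)]

open Polynomial.Chebyshev in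
theorem absComb_mvChebT_mul_aeval_T {n : ℕ} (i : Fin n) :
    ∀ b ∈ Set.range (mvChebT n),
      ∀ b' ∈ (aeval (MvPolynomial.X i) : ℝ[X] →ₐ[ℝ] MvPolynomial (Fin n) ℝ) ''
        Set.range (T ℝ), AbsComb (Set.range (mvChebT n)) (b * b') 1 := by
  rintro _ ⟨α, rfl⟩ _ ⟨_, ⟨k, rfl⟩, rfl⟩
  have h : mvChebT n α * aeval (MvPolynomial.X i) (T ℝ k) =
      (1 / 2 : ℝ) • mvChebT n (Function.update α i ((α i : ℤ) + k).natAbs) +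
      (1 / 2 : ℝ) • mvChebT n (Function.update α i ((α i : ℤ) - k).natAbs) := by
    rw [mvChebT_update, mvChebT_update, ← smul_mul_assoc, ← smul_mul_assoc, ← add_mul,
      ← map_smul, ← map_smul, ← map_add, ← T_mul_T_eq, map_mul, mvChebT,
      ← Finset.mul_prod_erase _ _ (Finset.mem_univ i), chebT]
    ring
  rw [h]
  exact (((AbsComb.of_mem (Set.mem_range_self _)).smul _).add
    ((AbsComb.of_mem (Set.mem_range_self _)).smul _)).mono (by norm_num)

theorem mvCheb1Norm_le_of_absComb {n : ℕ} {p : MvPolynomial (Fin n) ℝ} {s : ℝ}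
    (h : AbsComb (Set.range (mvChebT n)) p s) : mvCheb1Norm p ≤ s := by
  obtain ⟨c, hp, hc⟩ : ∃ c : (Fin n → ℕ) →₀ ℝ,
      p = c.sum (fun α coef => MvPolynomial.C coef * mvChebT n α) ∧
      c.sum (fun _ coef => |coef|) ≤ s := by
    induction h with
    | zero hs => exact ⟨0, by simp, by simpa using hs⟩
    | @smul_add p b s t a hb _ h ih =>
      obtain ⟨c, rfl, hc⟩ := ih
      obtain ⟨α, rfl⟩ := hb
      refine ⟨Finsupp.single α a + c, ?_, ?_⟩
      · rw [Finsupp.sum_add_index' (by simp) (by intros; rw [map_add, add_mul]),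
          Finsupp.sum_single_index (by simp), MvPolynomial.smul_eq_C_mul]
      · refine le_trans ?_ (h.trans' (add_le_add_right hc _))
        classical
        have hs : (Finsupp.single α a + c).support ⊆ insert α c.support := by
          intro x hx
          by_contra hx'
          simp only [Finset.mem_insert, not_or, Finsupp.mem_support_iff, not_not] at hx'
          simp [hx'.2, Ne.symm hx'.1] at hx
        rw [Finsupp.sum_of_support_subset _ hs _ (by simp),
          Finsupp.sum_of_support_subset c (Finset.subset_insert α _) _ (by simp)]
        calc ∑ x ∈ insert α c.support, |(Finsupp.single α a + c) x|
            ≤ ∑ x ∈ insert α c.support, (|Finsupp.single α a x| + |c x|) :=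
              Finset.sum_le_sum fun x _ => abs_add_le _ _
          _ = |a| + ∑ x ∈ insert α c.support, |c x| := by
              rw [Finset.sum_add_distrib]
              congr 1
              rw [Finset.sum_eq_single_of_mem α (by simp)]
              · simp
              · intro x _ hx
                simp [Ne.symm hx]
  rw [mvCheb1Norm]
  refine le_trans (csInf_le ⟨0, ?_⟩ ⟨c, hp, rfl⟩) hc
  rintro _ ⟨c, -, rfl⟩
  exact Finset.sum_nonneg fun _ _ => abs_nonneg _

open Polynomial.Chebyshev in
theorem absComb_prod_aeval_sub_prod {n : ℕ} {α : Fin n → ℕ} {q : Fin n → ℝ[X]} {ε : ℝ}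
    (hq : ∀ i, AbsComb (Set.range (T ℝ)) (q i - chebT (α i)) ε) :
    AbsComb (Set.range (mvChebT n))
      ((∏ i, aeval (MvPolynomial.X i) (q i)) - mvChebT n α) ((1 + ε) ^ n - 1) := by
  classical
  have hone : (1 : MvPolynomial (Fin n) ℝ) ∈ Set.range (mvChebT n) :=
    ⟨0, by simp [mvChebT, chebT]⟩
  have key : ∀ I : Finset (Fin n),
      AbsComb (Set.range (mvChebT n)) (∏ i ∈ I, aeval (MvPolynomial.X i) (chebT (α i))) 1 ∧
      AbsComb (Set.range (mvChebT n))
        ((∏ i ∈ I, aeval (MvPolynomial.X i) (q i)) -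
          ∏ i ∈ I, aeval (MvPolynomial.X i) (chebT (α i))) ((1 + ε) ^ I.card - 1) := by
    intro I
    induction I using Finset.induction_on with
    | empty => exact ⟨by simpa using AbsComb.of_mem hone, by simpa using AbsComb.zero le_rfl⟩
    | insert i I hi ih =>
      obtain ⟨ih1, ih2⟩ := ih
      have hT : AbsComb (Set.range (T ℝ)) (chebT (α i)) 1 := AbsComb.of_mem (Set.mem_range_self _)
      rw [Finset.prod_insert hi, Finset.prod_insert hi, Finset.card_insert_of_notMem hi]
      constructor
      · simpa [mul_comm] using ih1.mul (absComb_mvChebT_mul_aeval_T i) (hT.map _)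
      · have h1 := ih2.mul (absComb_mvChebT_mul_aeval_T i)
          ((hT.add (hq i)).map (aeval (MvPolynomial.X i)))
        have h2 := ih1.mul (absComb_mvChebT_mul_aeval_T i)
          ((hq i).map (aeval (MvPolynomial.X i)))
        have h3 := h1.add h2
        rw [add_sub_cancel, map_sub] at h3
        convert h3 using 1
        · ring
        · ring
  simpa [mvChebT] using (key Finset.univ).2

theorem sq_sum_cos_add_sq_sum_sin (φ : ℝ) (m : ℕ) :
    (∑ i ∈ Finset.range m, Real.cos (i * φ)) ^ 2 + (∑ i ∈ Finset.range m, Real.sin (i * φ)) ^ 2 =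
      m + 2 * ∑ j ∈ Finset.range m, ((m : ℝ) - (j + 1 : ℕ)) * Real.cos ((j + 1 : ℕ) * φ) := by
  induction m with
  | zero => simp
  | succ m ih =>
    have h : Real.cos (m * φ) * ∑ i ∈ Finset.range m, Real.cos (i * φ) +
        Real.sin (m * φ) * ∑ i ∈ Finset.range m, Real.sin (i * φ) =
        ∑ j ∈ Finset.range m, Real.cos ((j + 1 : ℕ) * φ) := by
      rw [← Finset.sum_range_reflect (fun j : ℕ => Real.cos ((j + 1 : ℕ) * φ)),
        Finset.mul_sum, Finset.mul_sum, ← Finset.sum_add_distrib]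
      refine Finset.sum_congr rfl fun i hi => ?_
      have hi' : m - 1 - i + 1 = m - i := by have := Finset.mem_range.1 hi; omega
      rw [hi', Nat.cast_sub (Finset.mem_range.1 hi).le, sub_mul, Real.cos_sub]
    have h' : ∑ j ∈ Finset.range (m + 1),
        (((m + 1 : ℕ) : ℝ) - (j + 1 : ℕ)) * Real.cos ((j + 1 : ℕ) * φ) =
        ∑ j ∈ Finset.range m, ((m : ℝ) - (j + 1 : ℕ)) * Real.cos ((j + 1 : ℕ) * φ) +
        ∑ j ∈ Finset.range m, Real.cos ((j + 1 : ℕ) * φ) := by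
      rw [Finset.sum_range_succ, sub_self, zero_mul, add_zero, ← Finset.sum_add_distrib]
      refine Finset.sum_congr rfl fun j _ => ?_
      push_cast; ring
    rw [h', Finset.sum_range_succ, Finset.sum_range_succ, Nat.cast_succ]
    linear_combination ih + 2 * h + Real.sin_sq_add_cos_sq (m * φ)

theorem sq_add_two_mul_sum_sq_mul_cos_nonneg (φ : ℝ) (m : ℕ) :
    0 ≤ (m : ℝ) ^ 2 +
      2 * ∑ j ∈ Finset.range m, ((m : ℝ) - (j + 1 : ℕ)) ^ 2 * Real.cos ((j + 1 : ℕ) * φ) := by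
  induction m with
  | zero => simp
  | succ m ih =>
    have h1 := sq_sum_cos_add_sq_sum_sin φ m
    have h2 := sq_sum_cos_add_sq_sum_sin φ (m + 1)
    have h' : ∑ j ∈ Finset.range (m + 1),
        (((m + 1 : ℕ) : ℝ) - (j + 1 : ℕ)) ^ 2 * Real.cos ((j + 1 : ℕ) * φ) =
        ∑ j ∈ Finset.range m, ((m : ℝ) - (j + 1 : ℕ)) ^ 2 * Real.cos ((j + 1 : ℕ) * φ) +
        ∑ j ∈ Finset.range m, ((m : ℝ) - (j + 1 : ℕ)) * Real.cos ((j + 1 : ℕ) * φ) +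
        ∑ j ∈ Finset.range (m + 1),
          (((m + 1 : ℕ) : ℝ) - (j + 1 : ℕ)) * Real.cos ((j + 1 : ℕ) * φ) := by
      rw [Finset.sum_range_succ, Finset.sum_range_succ _ m, sub_self, zero_pow two_ne_zero,
        zero_mul, add_zero, add_zero, ← Finset.sum_add_distrib,
        ← Finset.sum_add_distrib]
      refine Finset.sum_congr rfl fun j _ => ?_
      push_cast; ring
    rw [h', Nat.cast_succ]
    have e1 := add_nonneg (sq_nonneg (∑ i ∈ Finset.range m, Real.cos (i * φ)))
      (sq_nonneg (∑ i ∈ Finset.range m, Real.sin (i * φ)))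
    have e2 := add_nonneg (sq_nonneg (∑ i ∈ Finset.range (m + 1), Real.cos (i * φ)))
      (sq_nonneg (∑ i ∈ Finset.range (m + 1), Real.sin (i * φ)))
    rw [h1] at e1
    rw [h2, Nat.cast_succ] at e2
    linarith

theorem Finset.sum_Icc_neg_self {M : Type*} [AddCommMonoid M] (f : ℤ → M) (r : ℕ) :
    ∑ i ∈ Finset.Icc (-r : ℤ) r, f i = f 0 + ∑ j ∈ Finset.Icc 1 r, (f j + f (-j)) := by
  induction r with
  | zero => simp
  | succ r ih =>
    have h : Finset.Icc (-(r + 1 : ℕ) : ℤ) (r + 1 : ℕ) =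
        insert ((r + 1 : ℕ) : ℤ) (insert (-(r + 1 : ℕ) : ℤ) (Finset.Icc (-r : ℤ) r)) := by
      ext i; simp only [Finset.mem_insert, Finset.mem_Icc]; omega
    rw [h, Finset.sum_insert (by simp; omega), Finset.sum_insert (by simp), ih,
      Finset.sum_Icc_succ_top (by omega)]
    abel

theorem Finset.sum_Icc_neg_self_comp_neg {M : Type*} [AddCommMonoid M] (f : ℤ → M) (r : ℕ) :
    ∑ i ∈ Finset.Icc (-r : ℤ) r, f (-i) = ∑ i ∈ Finset.Icc (-r : ℤ) r, f i := by
  rw [Finset.sum_Icc_neg_self, Finset.sum_Icc_neg_self, neg_zero]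
  simp [add_comm]

theorem integral_chebMeasure (f : ℝ → ℝ) :
    ∫ y, f y ∂chebMeasure = Real.pi⁻¹ * ∫ θ in 0..Real.pi, f (Real.cos θ) := by
  rw [← Polynomial.Chebyshev.integral_measureT_eq_integral_cos,
    Polynomial.Chebyshev.integral_measureT, chebMeasure,
    integral_withDensity_eq_integral_toReal_smul (by fun_prop)
      (.of_forall fun _ => ENNReal.ofReal_lt_top),
    integral_Icc_eq_integral_Ioc, ← intervalIntegral.integral_of_le (by norm_num),
    ← intervalIntegral.integral_const_mul]
  congr 1
  ext y
  rw [ENNReal.toReal_ofReal (by positivity), smul_eq_mul, one_div, mul_inv, Real.sqrt_inv]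
  ring

/-- The integral of a polynomial against `chebMeasure`, as a linear functional. -/
noncomputable def chebMean : ℝ[X] →ₗ[ℝ] ℝ where
  toFun P := ∫ y, P.eval y ∂chebMeasure
  map_add' P Q := by
    simp only [integral_chebMeasure, eval_add]
    rw [intervalIntegral.integral_add, mul_add] <;>
      exact Continuous.intervalIntegrable (by fun_prop) _ _
  map_smul' c P := by
    simp only [integral_chebMeasure, eval_smul, smul_eq_mul, RingHom.id_apply]
    rw [intervalIntegral.integral_const_mul]
    ring

theorem chebMean_apply (P : ℝ[X]) : chebMean P = ∫ y, P.eval y ∂chebMeasure := rfl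

theorem abs_chebMean_le {P : ℝ[X]} {s : ℝ} (h : ∀ θ : ℝ, |P.eval (Real.cos θ)| ≤ s) :
    |chebMean P| ≤ s := by
  have h1 := intervalIntegral.norm_integral_le_of_norm_le_const (a := 0) (b := Real.pi)
    (f := fun θ => P.eval (Real.cos θ)) (C := s) fun θ _ => h θ
  rw [Real.norm_eq_abs, sub_zero, abs_of_pos Real.pi_pos] at h1
  rw [chebMean_apply, integral_chebMeasure, abs_mul, abs_of_pos (inv_pos.2 Real.pi_pos),
    inv_mul_le_iff₀ Real.pi_pos, mul_comm]
  exact h1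

namespace Polynomial.Chebyshev

theorem chebMean_T (n : ℤ) : chebMean (T ℝ n) = if n = 0 then 1 else 0 := by
  rw [chebMean_apply, integral_chebMeasure,
    ← integral_measureT_eq_integral_cos (f := fun y => (T ℝ n).eval y)]
  split_ifs with h
  · rw [h, integral_eval_T_real_measureT_zero, inv_mul_cancel₀ Real.pi_ne_zero]
  · rw [integral_eval_T_real_measureT_of_ne_zero h, mul_zero]

theorem chebMean_T_mul_T (i j : ℤ) : chebMean (T ℝ i * T ℝ j) =
    (1 / 2) * (if i + j = 0 then 1 else 0) + (1 / 2) * (if i - j = 0 then 1 else 0) := by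
  rw [T_mul_T_eq, map_add, map_smul, map_smul, chebMean_T, chebMean_T, smul_eq_mul, smul_eq_mul]

theorem absComb_of_abs_eval_cos_le {P : ℝ[X]} {D : ℕ} {s : ℝ} (hD : P.natDegree ≤ D)
    (h : ∀ θ : ℝ, |P.eval (Real.cos θ)| ≤ s) :
    AbsComb (Set.range (T ℝ)) P (2 * (D + 1) * s) := by
  have hmem : P ∈ degreeLT ℝ (D + 1) := by
    rw [mem_degreeLT]
    exact (degree_le_of_natDegree_le hD).trans_lt (by exact_mod_cast Nat.lt_succ_self D)
  rw [← Sequence.span_degreeLT (chebyshevTsequence ℝ) (by simp),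
    show Set.Iio (D + 1) = Finset.range (D + 1) by simp,
    Submodule.mem_span_image_finset_iff_exists_fun'] at hmem
  obtain ⟨c, hc⟩ := hmem
  have hP : P = ∑ k ∈ Finset.range (D + 1), c k • T ℝ (k : ℤ) := hc.symm
  have hck : ∀ k ∈ Finset.range (D + 1), |c k| ≤ 2 * s := by
    intro k hk
    have h1 : |chebMean (P * T ℝ k)| ≤ s := by
      refine abs_chebMean_le fun θ => ?_
      rw [eval_mul, abs_mul, T_real_cos]
      exact (mul_le_of_le_one_right (abs_nonneg _) (Real.abs_cos_le_one _)).trans (h θ)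
    have h2 : chebMean (P * T ℝ k) = c k * chebMean (T ℝ k * T ℝ k) := by
      rw [hP, Finset.sum_mul, map_sum, Finset.sum_eq_single_of_mem k hk]
      · rw [smul_mul_assoc, map_smul, smul_eq_mul]
      · intro j _ hj
        rw [smul_mul_assoc, map_smul, chebMean_T_mul_T, if_neg (by omega), if_neg (by omega)]
        simp
    have h3 : 1 / 2 ≤ chebMean (T ℝ k * T ℝ k) := by
      rw [chebMean_T_mul_T, sub_self, if_pos rfl]
      split_ifs <;> norm_num
    rw [h2, abs_mul, abs_of_pos (a := chebMean _) (by linarith)] at h1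
    nlinarith [abs_nonneg (c k)]
  rw [hP]
  refine (AbsComb.sum _ fun k _ => (AbsComb.of_mem (Set.mem_range_self _)).smul (c k)).mono ?_
  calc ∑ k ∈ Finset.range (D + 1), |c k| * 1 ≤ ∑ _k ∈ Finset.range (D + 1), 2 * s :=
        Finset.sum_le_sum fun k hk => by rw [mul_one]; exact hck k hk
    _ = 2 * (D + 1) * s := by simp; ring

end Polynomial.Chebyshev

/-- The coefficients `1 - â_{|i|}` of the Fejér kernel, indexed by `ℤ`. -/
noncomputable def fejerCoeff (r : ℕ) (i : ℤ) : ℝ := 1 - fejerWeights r i.natAbs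

theorem fejerCoeff_neg (r : ℕ) (i : ℤ) : fejerCoeff r (-i) = fejerCoeff r i := by
  simp [fejerCoeff]

theorem fejerCoeff_zero (r : ℕ) : fejerCoeff r 0 = 1 := by
  simp [fejerCoeff, fejerWeights]

theorem fejerCoeff_natCast_of_le {r j : ℕ} (hj : j ≤ r) : fejerCoeff r j = 1 - (j : ℝ) / r := by
  simp [fejerCoeff, fejerWeights, hj]

theorem fejerCoeff_eq_zero {r : ℕ} {i : ℤ} (hi : i ∉ Finset.Icc (-r : ℤ) r) :
    fejerCoeff r i = 0 := by
  have h : ¬ i.natAbs ≤ r := by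
    rw [Finset.mem_Icc] at hi
    omega
  simp [fejerCoeff, fejerWeights, h]

theorem fejerCoeff_eq_max {r : ℕ} (hr : 0 < r) (i : ℤ) :
    fejerCoeff r i = max (1 - (|i| : ℤ) / (r : ℝ)) 0 := by
  have hr' : (0 : ℝ) < r := by exact_mod_cast hr
  rw [fejerCoeff, fejerWeights, Int.abs_eq_natAbs, Int.cast_natCast]
  split_ifs with h
  · rw [max_eq_left]
    rw [sub_nonneg, div_le_one hr']
    exact_mod_cast h
  · rw [max_eq_right, sub_self]
    rw [sub_nonpos, one_le_div hr']
    exact_mod_cast (not_le.1 h).le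

theorem sq_fejerCoeff_sub_le {r : ℕ} (hr : 0 < r) (k : ℕ) (i : ℤ) :
    (fejerCoeff r i - fejerCoeff r (k - i)) ^ 2 ≤ ((k : ℝ) / r) ^ 2 := by
  have hr' : (0 : ℝ) < r := by exact_mod_cast hr
  rw [sq_le_sq, fejerCoeff_eq_max hr, fejerCoeff_eq_max hr]
  refine (abs_max_sub_max_le_abs _ _ _).trans ?_
  rw [sub_sub_sub_cancel_left, ← sub_div, abs_div, abs_div]
  refine div_le_div_of_nonneg_right ?_ (abs_nonneg _)
  have h : |(|(k - i : ℤ)| - |i| : ℤ)| ≤ |(k : ℤ)| := by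
    have h1 := abs_abs_sub_abs_le (k - i : ℤ) (-i)
    rwa [abs_neg, sub_neg_eq_add, sub_add_cancel] at h1
  exact_mod_cast h

theorem Cval_fejerWeights (r : ℕ) :
    Cval r (fejerWeights r) = ∑ i ∈ Finset.Icc (-r : ℤ) r, fejerCoeff r i ^ 2 := by
  rw [Finset.sum_Icc_neg_self, Cval, fejerCoeff_zero, one_pow, Finset.mul_sum]
  congr 1
  refine Finset.sum_congr rfl fun j _ => ?_
  rw [fejerCoeff_neg, fejerCoeff, Int.natAbs_natCast]
  ring

theorem two_mul_div_three_le_Cval {r : ℕ} (hr : 0 < r) :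
    2 * (r : ℝ) / 3 ≤ Cval r (fejerWeights r) := by
  have hr' : (0 : ℝ) < r := by exact_mod_cast hr
  have h1 : ∀ m : ℕ, ∑ j ∈ Finset.Icc 1 m, (1 - (j : ℝ) / r) ^ 2 =
      m - m * (m + 1) / r + m * (m + 1) * (2 * m + 1) / (6 * (r : ℝ) ^ 2) := by
    intro m
    induction m with
    | zero => simp
    | succ m ih =>
      rw [Finset.sum_Icc_succ_top (by omega), ih]
      push_cast
      field
  have h2 : ∑ j ∈ Finset.Icc 1 r, (1 - fejerWeights r j) ^ 2 =
      ∑ j ∈ Finset.Icc 1 r, (1 - (j : ℝ) / r) ^ 2 := by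
    refine Finset.sum_congr rfl fun j hj => ?_
    rw [fejerWeights, if_pos (Finset.mem_Icc.1 hj).2]
  rw [Cval, h2, h1]
  have h3 : 1 + 2 * ((r : ℝ) - r * (r + 1) / r + r * (r + 1) * (2 * r + 1) / (6 * (r : ℝ) ^ 2)) =
      2 * r / 3 + 1 / (3 * r) := by
    field
  rw [h3]
  exact le_add_of_nonneg_right (by positivity)

namespace Polynomial.Chebyshev

theorem MPoly_fejerWeights (r : ℕ) : MPoly r (fejerWeights r) =
    ∑ i ∈ Finset.Icc (-r : ℤ) r, fejerCoeff r i ^ 2 • (T ℝ i * T ℝ i) := by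
  rw [Finset.sum_Icc_neg_self, MPoly, fejerCoeff_zero, T_zero, Finset.mul_sum]
  congr 1
  · simp
  refine Finset.sum_congr rfl fun j _ => ?_
  rw [fejerCoeff_neg, T_neg, fejerCoeff, Int.natAbs_natCast, smul_eq_C_mul, chebT, C_ofNat]
  ring

theorem Sker_fejerWeights (r : ℕ) (x y : ℝ) : Sker r (fejerWeights r) x y =
    (∑ i ∈ Finset.Icc (-r : ℤ) r, (fejerCoeff r i * (T ℝ i).eval x) • T ℝ i).eval y := by
  rw [eval_finsetSum, Finset.sum_Icc_neg_self, Sker, fejerCoeff_zero, T_zero, Finset.mul_sum]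
  congr 1
  · simp
  refine Finset.sum_congr rfl fun j _ => ?_
  rw [fejerCoeff_neg, T_neg, fejerCoeff, Int.natAbs_natCast, chebT, eval_smul, smul_eq_mul]
  ring

theorem sq_sum_smul_T {g : ℤ → ℝ} (hg : ∀ i, g (-i) = g i) (r : ℕ) :
    (∑ i ∈ Finset.Icc (-r : ℤ) r, g i • T ℝ i) ^ 2 =
      ∑ i ∈ Finset.Icc (-r : ℤ) r, ∑ j ∈ Finset.Icc (-r : ℤ) r, (g i * g j) • T ℝ (i + j) := by
  rw [sq, Finset.sum_mul_sum]
  refine Finset.sum_congr rfl fun i _ => ?_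
  have h := Finset.sum_Icc_neg_self_comp_neg (fun j => (g i * g j) • T ℝ (i + j)) r
  simp only [hg, ← sub_eq_add_neg] at h
  calc ∑ j ∈ Finset.Icc (-r : ℤ) r, g i • T ℝ i * g j • T ℝ j
      = (1 / 2 : ℝ) • ∑ j ∈ Finset.Icc (-r : ℤ) r, (g i * g j) • T ℝ (i + j) +
        (1 / 2 : ℝ) • ∑ j ∈ Finset.Icc (-r : ℤ) r, (g i * g j) • T ℝ (i - j) := by
        rw [Finset.smul_sum, Finset.smul_sum, ← Finset.sum_add_distrib]
        refine Finset.sum_congr rfl fun j _ => ?_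
        rw [smul_mul_smul_comm, T_mul_T_eq]
        module
    _ = _ := by rw [h]; module

theorem chebMean_T_mul_sq_sum {g : ℤ → ℝ} (hg : ∀ i, g (-i) = g i) {r : ℕ}
    (hg0 : ∀ i ∉ Finset.Icc (-r : ℤ) r, g i = 0) (k : ℤ) :
    chebMean (T ℝ k * (∑ i ∈ Finset.Icc (-r : ℤ) r, g i • T ℝ i) ^ 2) =
      ∑ i ∈ Finset.Icc (-r : ℤ) r, g i * g (k - i) := by
  have hsum : ∀ k i : ℤ, ∑ j ∈ Finset.Icc (-r : ℤ) r, (g i * g j) *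
      (if k - (i + j) = 0 then 1 else 0) = g i * g (k - i) := by
    intro k i
    by_cases h : k - i ∈ Finset.Icc (-r : ℤ) r
    · rw [Finset.sum_eq_single_of_mem _ h]
      · simp
      · intro j _ hj
        rw [if_neg (by omega), mul_zero]
    · rw [hg0 _ h, mul_zero]
      refine Finset.sum_eq_zero fun j hj => ?_
      rw [if_neg, mul_zero]
      intro h'
      exact h (by rwa [show k - i = j by omega])
  have hflip := Finset.sum_Icc_neg_self_comp_neg (fun i => g i * g (k - i)) r
  have hneg : ∀ i, g (-i) * g (k - -i) = g i * g (-k - i) := by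
    intro i
    rw [hg, ← hg (k - -i)]
    congr 2
    ring
  simp only [hneg] at hflip
  calc chebMean (T ℝ k * (∑ i ∈ Finset.Icc (-r : ℤ) r, g i • T ℝ i) ^ 2)
      = ∑ i ∈ Finset.Icc (-r : ℤ) r, ((1 / 2) * (g i * g (-k - i)) +
          (1 / 2) * (g i * g (k - i))) := by
        rw [sq_sum_smul_T hg, Finset.mul_sum, map_sum]
        refine Finset.sum_congr rfl fun i _ => ?_
        rw [← hsum, ← hsum, Finset.mul_sum, Finset.mul_sum, Finset.mul_sum, map_sum,
          ← Finset.sum_add_distrib]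
        refine Finset.sum_congr rfl fun j _ => ?_
        rw [mul_smul_comm, map_smul, chebMean_T_mul_T, smul_eq_mul]
        simp only [show -k - (i + j) = 0 ↔ k + (i + j) = 0 by omega]
        ring
    _ = ∑ i ∈ Finset.Icc (-r : ℤ) r, g i * g (k - i) := by
        rw [Finset.sum_add_distrib, ← Finset.mul_sum, ← Finset.mul_sum, hflip]
        ring

theorem eq_sum_of_eval_eq_integral {r k : ℕ} {q : ℝ[X]}
    (hq : ∀ x : ℝ, q.eval x =
      ∫ y, (chebT k).eval y * (Sker r (fejerWeights r) x y) ^ 2 ∂chebMeasure) :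
    q = ∑ i ∈ Finset.Icc (-r : ℤ) r,
      (fejerCoeff r i * fejerCoeff r (k - i)) • (T ℝ i * T ℝ (k - i)) := by
  refine Polynomial.funext fun x => ?_
  have h := chebMean_T_mul_sq_sum (g := fun i => fejerCoeff r i * (T ℝ i).eval x) (r := r)
    (fun i => by simp only [fejerCoeff_neg, T_neg])
    (fun i hi => by simp only [fejerCoeff_eq_zero hi, zero_mul]) k
  rw [chebMean_apply] at h
  simp only [eval_mul, eval_pow, ← Sker_fejerWeights] at h
  rw [hq, chebT, h, eval_finsetSum]
  refine Finset.sum_congr rfl fun i _ => ?_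
  rw [eval_smul, eval_mul, smul_eq_mul]
  ring

theorem MPoly_mul_T_sub_eq (r k : ℕ) :
    MPoly r (fejerWeights r) * T ℝ k - ∑ i ∈ Finset.Icc (-r : ℤ) r,
      (fejerCoeff r i * fejerCoeff r (k - i)) • (T ℝ i * T ℝ (k - i)) =
    ∑ i ∈ Finset.Icc (-r : ℤ) (k + r),
      ((fejerCoeff r i - fejerCoeff r (k - i)) ^ 2 / 4) • (T ℝ k + T ℝ (2 * i - k)) := by
  have hsub : Finset.Icc (-r : ℤ) r ⊆ Finset.Icc (-r : ℤ) (k + r) :=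
    Finset.Icc_subset_Icc_right (by omega)
  have hM : MPoly r (fejerWeights r) * T ℝ k = (1 / 2 : ℝ) •
      ∑ i ∈ Finset.Icc (-r : ℤ) (k + r),
        fejerCoeff r i ^ 2 • (T ℝ k + T ℝ (2 * i - k)) := by
    have hflip := Finset.sum_Icc_neg_self_comp_neg
      (fun i => fejerCoeff r i ^ 2 • T ℝ (2 * i - k)) r
    have hT : ∀ i : ℤ, T ℝ (2 * -i - k) = T ℝ (2 * i + k) := by
      intro i
      rw [← T_neg]
      congr 1
      ring
    simp only [fejerCoeff_neg, hT] at hflip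
    rw [← Finset.sum_subset hsub fun i _ hi => by
      rw [fejerCoeff_eq_zero hi, zero_pow two_ne_zero, zero_smul]]
    calc MPoly r (fejerWeights r) * T ℝ k
        = (1 / 2 : ℝ) • ∑ i ∈ Finset.Icc (-r : ℤ) r, fejerCoeff r i ^ 2 • T ℝ k +
          (1 / 4 : ℝ) • ∑ i ∈ Finset.Icc (-r : ℤ) r, fejerCoeff r i ^ 2 • T ℝ (2 * i + k) +
          (1 / 4 : ℝ) • ∑ i ∈ Finset.Icc (-r : ℤ) r, fejerCoeff r i ^ 2 • T ℝ (2 * i - k) := by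
          rw [MPoly_fejerWeights, Finset.sum_mul, Finset.smul_sum, Finset.smul_sum,
            Finset.smul_sum, ← Finset.sum_add_distrib, ← Finset.sum_add_distrib]
          refine Finset.sum_congr rfl fun i _ => ?_
          rw [T_mul_T_eq i i, sub_self, T_zero, smul_mul_assoc, add_mul, smul_mul_assoc,
            smul_mul_assoc, one_mul, T_mul_T_eq, ← two_mul]
          module
      _ = _ := by
          rw [hflip]
          simp only [smul_add, Finset.sum_add_distrib]
          module
  have hQ : ∑ i ∈ Finset.Icc (-r : ℤ) r,
      (fejerCoeff r i * fejerCoeff r (k - i)) • (T ℝ i * T ℝ (k - i)) = (1 / 2 : ℝ) •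
      ∑ i ∈ Finset.Icc (-r : ℤ) (k + r),
        (fejerCoeff r i * fejerCoeff r (k - i)) • (T ℝ k + T ℝ (2 * i - k)) := by
    rw [← Finset.sum_subset hsub fun i _ hi => by
      rw [fejerCoeff_eq_zero hi, zero_mul, zero_smul], Finset.smul_sum]
    refine Finset.sum_congr rfl fun i _ => ?_
    rw [T_mul_T_eq, show i + (k - i) = (k : ℤ) by ring,
      show i - (k - i) = 2 * i - (k : ℤ) by ring]
    module
  have hrefl : ∑ i ∈ Finset.Icc (-r : ℤ) (k + r),
        fejerCoeff r (k - i) ^ 2 • (T ℝ k + T ℝ (2 * i - k)) =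
      ∑ i ∈ Finset.Icc (-r : ℤ) (k + r),
        fejerCoeff r i ^ 2 • (T ℝ k + T ℝ (2 * i - k)) := by
    refine Finset.sum_nbij' (fun i => k - i) (fun i => k - i) ?_ ?_ ?_ ?_ ?_
    · intro i hi; rw [Finset.mem_Icc] at hi ⊢; omega
    · intro i hi; rw [Finset.mem_Icc] at hi ⊢; omega
    · intro i _; ring
    · intro i _; ring
    · intro i _
      rw [← T_neg ℝ (2 * i - k)]
      congr 3
      ring
  calc _ = (1 / 4 : ℝ) • ∑ i ∈ Finset.Icc (-r : ℤ) (k + r),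
          fejerCoeff r i ^ 2 • (T ℝ k + T ℝ (2 * i - k)) +
        (1 / 4 : ℝ) • ∑ i ∈ Finset.Icc (-r : ℤ) (k + r),
          fejerCoeff r (k - i) ^ 2 • (T ℝ k + T ℝ (2 * i - k)) -
        (1 / 2 : ℝ) • ∑ i ∈ Finset.Icc (-r : ℤ) (k + r),
          (fejerCoeff r i * fejerCoeff r (k - i)) • (T ℝ k + T ℝ (2 * i - k)) := by
        rw [hM, hQ, hrefl]; module
    _ = _ := by
        rw [Finset.smul_sum, Finset.smul_sum, Finset.smul_sum, ← Finset.sum_add_distrib,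
          ← Finset.sum_sub_distrib]
        refine Finset.sum_congr rfl fun i _ => ?_
        rw [smul_smul, smul_smul, smul_smul, ← add_smul, ← sub_smul]
        congr 1
        ring

theorem absComb_MPoly_mul_T_sub {r : ℕ} (hr : 0 < r) (k : ℕ) :
    AbsComb (Set.range (T ℝ)) (MPoly r (fejerWeights r) * T ℝ k -
      ∑ i ∈ Finset.Icc (-r : ℤ) r,
        (fejerCoeff r i * fejerCoeff r (k - i)) • (T ℝ i * T ℝ (k - i)))
      ((2 * r + k + 1) * ((k : ℝ) / r) ^ 2 / 2) := by
  rw [MPoly_mul_T_sub_eq]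
  refine (AbsComb.sum _ (g := fun _ => ((k : ℝ) / r) ^ 2 / 2) fun i _ => ?_).mono ?_
  · refine (((AbsComb.of_mem (Set.mem_range_self _)).add
      (AbsComb.of_mem (Set.mem_range_self _))).smul _).mono ?_
    have := sq_fejerCoeff_sub_le hr k i
    rw [abs_of_nonneg (by positivity)]
    linarith
  · rw [Finset.sum_const, Int.card_Icc, nsmul_eq_mul,
      show ((k + r + 1 - -r : ℤ).toNat) = 2 * r + k + 1 by omega]
    push_cast
    exact le_of_eq (by ring)

end Polynomial.Chebyshev

theorem sum_sq_fejerCoeff_mul_cos_nonneg {r : ℕ} (hr : 0 < r) (φ : ℝ) :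
    0 ≤ ∑ i ∈ Finset.Icc (-r : ℤ) r, fejerCoeff r i ^ 2 * Real.cos (i * φ) := by
  have hr' : (0 : ℝ) < r := by exact_mod_cast hr
  have h : (r : ℝ) ^ 2 * ∑ i ∈ Finset.Icc (-r : ℤ) r, fejerCoeff r i ^ 2 * Real.cos (i * φ) =
      (r : ℝ) ^ 2 +
      2 * ∑ j ∈ Finset.range r, ((r : ℝ) - (j + 1 : ℕ)) ^ 2 * Real.cos ((j + 1 : ℕ) * φ) := by
    rw [Finset.sum_Icc_neg_self, fejerCoeff_zero, mul_add, ← Finset.Ico_add_one_right_eq_Icc,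
      Finset.sum_Ico_eq_sum_range, Finset.mul_sum, Finset.mul_sum]
    congr 1
    · simp
    · refine Finset.sum_congr rfl fun j hj => ?_
      have hj' : 1 + j ≤ r := by have := Finset.mem_range.1 hj; omega
      rw [fejerCoeff_neg, fejerCoeff_natCast_of_le hj', Int.cast_neg, neg_mul, Real.cos_neg,
        Int.cast_natCast, add_comm 1 j]
      field
  have h' := sq_add_two_mul_sum_sq_mul_cos_nonneg φ r
  rw [← h] at h'
  exact nonneg_of_mul_nonneg_right h' (by positivity)

namespace Polynomial.Chebyshev

theorem natDegree_MPoly_le (r : ℕ) (a : ℕ → ℝ) : (MPoly r a).natDegree ≤ 2 * r := by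
  refine (natDegree_add_le _ _).trans (max_le (by simp) ?_)
  refine (natDegree_C_mul_le _ _).trans (natDegree_sum_le_of_forall_le _ _ fun j hj => ?_)
  refine (natDegree_C_mul_le _ _).trans (natDegree_pow_le.trans ?_)
  rw [chebT, natDegree_T, Int.natAbs_natCast]
  have := (Finset.mem_Icc.1 hj).2
  gcongr

theorem eval_cos_MPoly_fejerWeights (r : ℕ) (θ : ℝ) :
    (MPoly r (fejerWeights r)).eval (Real.cos θ) =
      ∑ i ∈ Finset.Icc (-r : ℤ) r, fejerCoeff r i ^ 2 * Real.cos (i * θ) ^ 2 := by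
  rw [MPoly_fejerWeights, eval_finsetSum]
  refine Finset.sum_congr rfl fun i _ => ?_
  rw [eval_smul, eval_mul, T_real_cos, smul_eq_mul, sq (Real.cos _)]

theorem eval_cos_MPoly_le (r : ℕ) (θ : ℝ) :
    (MPoly r (fejerWeights r)).eval (Real.cos θ) ≤ Cval r (fejerWeights r) := by
  rw [eval_cos_MPoly_fejerWeights, Cval_fejerWeights]
  exact Finset.sum_le_sum fun i _ =>
    mul_le_of_le_one_right (sq_nonneg _) (Real.cos_sq_le_one _)

theorem Cval_div_two_le_eval_cos_MPoly {r : ℕ} (hr : 0 < r) (θ : ℝ) :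
    Cval r (fejerWeights r) / 2 ≤ (MPoly r (fejerWeights r)).eval (Real.cos θ) := by
  have h : (MPoly r (fejerWeights r)).eval (Real.cos θ) = Cval r (fejerWeights r) / 2 +
      (∑ i ∈ Finset.Icc (-r : ℤ) r, fejerCoeff r i ^ 2 * Real.cos (i * (2 * θ))) / 2 := by
    rw [eval_cos_MPoly_fejerWeights, Cval_fejerWeights, ← add_div, ← Finset.sum_add_distrib,
      Finset.sum_div]
    refine Finset.sum_congr rfl fun i _ => ?_
    rw [Real.cos_sq, ← mul_assoc, ← mul_assoc, mul_comm 2 (i : ℝ)]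
    ring
  rw [h]
  linarith [sum_sq_fejerCoeff_mul_cos_nonneg hr (2 * θ)]

theorem Cval_pos {r : ℕ} (hr : 0 < r) : 0 < Cval r (fejerWeights r) := by
  have hr' : (0 : ℝ) < r := by exact_mod_cast hr
  exact lt_of_lt_of_le (by positivity) (two_mul_div_three_le_Cval hr)

theorem absComb_one_sub_MPoly {r : ℕ} (hr : 0 < r) : AbsComb (Set.range (T ℝ))
    (1 - Polynomial.C (1 / Cval r (fejerWeights r)) * MPoly r (fejerWeights r)) 1 := by
  have hC := Cval_pos hr
  have h1 : (1 : ℝ[X]) - Polynomial.C (1 / Cval r (fejerWeights r)) * MPoly r (fejerWeights r) =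
      (1 / Cval r (fejerWeights r)) • ∑ i ∈ Finset.Icc (-r : ℤ) r,
        (fejerCoeff r i ^ 2 / 2) • (1 - T ℝ (2 * i)) := by
    have h2 : ∑ i ∈ Finset.Icc (-r : ℤ) r, (fejerCoeff r i ^ 2 / 2) • (1 - T ℝ (2 * i)) =
        Cval r (fejerWeights r) • (1 : ℝ[X]) - MPoly r (fejerWeights r) := by
      rw [Cval_fejerWeights, MPoly_fejerWeights, Finset.sum_smul, ← Finset.sum_sub_distrib]
      refine Finset.sum_congr rfl fun i _ => ?_
      rw [T_mul_T_eq, sub_self, T_zero, ← two_mul]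
      module
    rw [h2, smul_sub, smul_smul, one_div, inv_mul_cancel₀ hC.ne', one_smul, smul_eq_C_mul]
  rw [h1]
  refine ((AbsComb.sum _ (g := fun i => fejerCoeff r i ^ 2) fun i _ => ?_).smul _).mono ?_
  · refine (((AbsComb.of_mem one_mem_range_T).sub
      (AbsComb.of_mem (Set.mem_range_self _))).smul _).mono ?_
    rw [abs_of_nonneg (by positivity)]
    linarith
  · rw [← Cval_fejerWeights, abs_of_pos (by positivity), one_div, inv_mul_cancel₀ hC.ne']

theorem absComb_one_sub_MPoly_pow {r : ℕ} (hr : 0 < r) (m : ℕ) : AbsComb (Set.range (T ℝ))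
    ((1 - Polynomial.C (1 / Cval r (fejerWeights r)) * MPoly r (fejerWeights r)) ^ m)
    (2 * (2 * r * m + 1) * (1 / 2) ^ m) := by
  have hC := Cval_pos hr
  have hdeg : ((1 - Polynomial.C (1 / Cval r (fejerWeights r)) *
      MPoly r (fejerWeights r)) ^ m).natDegree ≤ m * (2 * r) := by
    refine natDegree_pow_le.trans (Nat.mul_le_mul_left m ?_)
    refine (natDegree_sub_le _ _).trans (max_le (by simp) ?_)
    exact (natDegree_C_mul_le _ _).trans (natDegree_MPoly_le _ _)
  refine (absComb_of_abs_eval_cos_le (s := (1 / 2) ^ m) hdeg fun θ => ?_).mono ?_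
  · rw [eval_pow, abs_pow]
    gcongr
    rw [eval_sub, eval_one, eval_mul, eval_C, one_div, inv_mul_eq_div]
    have h1 := (div_le_one hC).2 (eval_cos_MPoly_le r θ)
    have h2 := (le_div_iff₀ hC).2
      ((div_mul_eq_mul_div 1 2 (Cval r (fejerWeights r))).trans_le
        ((congrArg (· / 2) (one_mul _)).trans_le (Cval_div_two_le_eval_cos_MPoly hr θ)))
    rw [abs_le]
    constructor <;> linarith
  · push_cast
    exact le_of_eq (by ring)

theorem pPoly_mul_MPoly (r : ℕ) (a : ℕ → ℝ) (N : ℕ) :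
    pPoly r a N * MPoly r a = 1 - (1 - Polynomial.C (1 / Cval r a) * MPoly r a) ^ (N + 1) := by
  have h := geom_sum_mul (1 - Polynomial.C (1 / Cval r a) * MPoly r a) (N + 1)
  rw [pPoly]
  linear_combination -h

theorem absComb_pPoly {r : ℕ} (hr : 0 < r) (N : ℕ) : AbsComb (Set.range (T ℝ))
    (pPoly r (fejerWeights r) N) ((N + 1) / Cval r (fejerWeights r)) := by
  rw [pPoly, ← smul_eq_C_mul]
  refine ((AbsComb.sum _ (g := fun _ => 1) fun m _ => ?_).smul _).mono ?_
  · simpa using (absComb_one_sub_MPoly hr).pow absComb_mul_of_mem_range_T one_mem_range_T m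
  · have hC := Cval_pos hr
    rw [abs_of_pos (by positivity)]
    simp [div_eq_inv_mul]

theorem absComb_pPoly_mul_sub {r k : ℕ} (hr : 0 < r) (N : ℕ) {q : ℝ[X]}
    (hq : ∀ x : ℝ, q.eval x =
      ∫ y, (chebT k).eval y * (Sker r (fejerWeights r) x y) ^ 2 ∂chebMeasure) :
    AbsComb (Set.range (T ℝ)) (pPoly r (fejerWeights r) N * q - chebT k)
      ((N + 1) / Cval r (fejerWeights r) * ((2 * r + k + 1) * ((k : ℝ) / r) ^ 2 / 2) +
        2 * (2 * r * (N + 1) + 1) * (1 / 2) ^ (N + 1)) := by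
  have h1 := (absComb_pPoly hr N).mul absComb_mul_of_mem_range_T (absComb_MPoly_mul_T_sub hr k)
  have h2 := (absComb_one_sub_MPoly_pow hr (N + 1)).mul absComb_mul_of_mem_range_T
    (AbsComb.of_mem (Set.mem_range_self (f := T ℝ) (k : ℤ)))
  rw [← eq_sum_of_eval_eq_integral hq] at h1
  convert (h1.add h2).neg using 1
  · rw [chebT]
    linear_combination T ℝ (k : ℤ) * pPoly_mul_MPoly r (fejerWeights r) N
  · push_cast
    ring

end Polynomial.Chebyshev

theorem one_add_pow_sub_one_le {n : ℕ} {ε : ℝ} (hε : 0 ≤ ε) (h : n * ε ≤ 1) :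
    (1 + ε) ^ n - 1 ≤ Real.exp 1 * n * ε := by
  have h1 : (1 + ε) ^ n ≤ Real.exp (n * ε) := by
    rw [Real.exp_nat_mul]
    gcongr
    linarith [Real.add_one_le_exp ε]
  have h2 : Real.exp (n * ε) - 1 ≤ n * ε * Real.exp (n * ε) := by
    have h3 := Real.add_one_le_exp (-(n * ε))
    have h4 : Real.exp (-(n * ε)) * Real.exp (n * ε) = 1 := by
      rw [← Real.exp_add, neg_add_cancel, Real.exp_zero]
    nlinarith [Real.exp_pos (n * ε)]
  have h5 : n * ε * Real.exp (n * ε) ≤ n * ε * Real.exp 1 := by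
    gcongr
  linarith

theorem fejer_error_le {d r k N : ℕ} (hd : 1 ≤ d) (hr : 45 * d ^ 2 ≤ r) (hk : k ≤ d)
    (hN : N = ⌈3 * Real.logb 2 r⌉₊) :
    (N + 1) / Cval r (fejerWeights r) * ((2 * r + k + 1) * ((k : ℝ) / r) ^ 2 / 2) +
        2 * (2 * r * (N + 1) + 1) * (1 / 2) ^ (N + 1) ≤
      (45 * (d : ℝ) ^ 2 * (Real.logb 2 r + 1) + 4) / (r : ℝ) ^ 2 := by
  have hdr : d + 1 ≤ r := by nlinarith
  have hr0 : 0 < r := by omega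
  have hr1 : (1 : ℝ) ≤ r := by exact_mod_cast hr0
  have hrpos : (0 : ℝ) < r := by linarith
  have hd1 : (1 : ℝ) ≤ d := by exact_mod_cast hd
  have hkd : (k : ℝ) ≤ d := by exact_mod_cast hk
  have hkr : (k : ℝ) + 1 ≤ r := by exact_mod_cast (by omega : k + 1 ≤ r)
  have hC := two_mul_div_three_le_Cval hr0
  set L := Real.logb 2 r with hL
  have hL0 : 0 ≤ L := Real.logb_nonneg (by norm_num) hr1
  have hN1 : (N : ℝ) ≤ 3 * L + 1 := by
    rw [hN]; exact (Nat.ceil_lt_add_one (by positivity)).le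
  have hpow : (1 / 2 : ℝ) ^ (N + 1) ≤ 1 / (2 * (r : ℝ) ^ 3) := by
    rw [one_div_pow]
    refine one_div_le_one_div_of_le (by positivity) ?_
    rw [pow_succ (2 : ℝ) N, mul_comm]
    gcongr
    calc (r : ℝ) ^ 3 = ((2 : ℝ) ^ L) ^ 3 := by
          rw [hL, Real.rpow_logb (by norm_num) (by norm_num) hrpos]
      _ = (2 : ℝ) ^ (3 * L) := by
          rw [← Real.rpow_natCast, ← Real.rpow_mul (by norm_num), mul_comm]
          norm_num
      _ ≤ (2 : ℝ) ^ (N : ℝ) := by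
          refine Real.rpow_le_rpow_of_exponent_le (by norm_num) ?_
          rw [hN]; exact Nat.le_ceil _
      _ = (2 : ℝ) ^ N := Real.rpow_natCast _ _
  have hN2 : (N : ℝ) + 1 ≤ 3 * L + 2 := by linarith
  have hk3 : 2 * (r : ℝ) + k + 1 ≤ 3 * r := by linarith
  have h1 : (N + 1) / Cval r (fejerWeights r) * ((2 * r + k + 1) * ((k : ℝ) / r) ^ 2 / 2) ≤
      (3 * L + 2) / (2 * r / 3) * ((3 * r) * ((d : ℝ) / r) ^ 2 / 2) := by
    gcongr
  have h2 : 2 * (2 * r * (N + 1) + 1) * (1 / 2 : ℝ) ^ (N + 1) ≤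
      2 * (2 * r * (3 * L + 2) + r) * (1 / (2 * (r : ℝ) ^ 3)) := by
    gcongr
  refine (add_le_add h1 h2).trans ?_
  have h3 : (3 * L + 2) / (2 * r / 3) * ((3 * r) * ((d : ℝ) / r) ^ 2 / 2) +
      2 * (2 * r * (3 * L + 2) + r) * (1 / (2 * (r : ℝ) ^ 3)) =
      (9 / 4 * (3 * L + 2) * (d : ℝ) ^ 2 + 6 * L + 5) / (r : ℝ) ^ 2 := by
    field
  rw [h3]
  refine div_le_div_of_nonneg_right ?_ (by positivity)
  nlinarith [mul_nonneg hL0 (sub_nonneg.2 (one_le_pow₀ hd1 (n := 2))),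
    one_le_pow₀ hd1 (n := 2)]

theorem natCast_mul_fejer_error_le_one {n d r : ℕ} (hd : 1 ≤ d) (hn : 1 ≤ n)
    (hr : 45 * n * d ^ 2 ≤ r) :
    n * ((45 * (d : ℝ) ^ 2 * (Real.logb 2 r + 1) + 4) / (r : ℝ) ^ 2) ≤ 1 := by
  have hd2 : 1 ≤ d ^ 2 := Nat.one_le_pow _ _ hd
  have hnr : 45 * n ≤ r := (Nat.le_mul_of_pos_right _ hd2).trans hr
  have hrpos : (0 : ℝ) < r := by exact_mod_cast (by omega : 0 < r)
  have hpow : ∀ m : ℕ, 2 ≤ m → m + 2 ≤ 2 ^ m := by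
    intro m hm
    induction m, hm using Nat.le_induction with
    | base => norm_num
    | succ m hm ih => rw [pow_succ]; omega
  have hL : Real.logb 2 r ≤ r - 2 := by
    rw [Real.logb_le_iff_le_rpow (by norm_num) hrpos]
    have h := hpow (r - 2) (by omega)
    rw [show r - 2 + 2 = r by omega] at h
    have h' : (r : ℝ) - 2 = ((r - 2 : ℕ) : ℝ) := by
      rw [Nat.cast_sub (by omega)]; norm_num
    rw [h', Real.rpow_natCast]
    exact_mod_cast h
  have hL0 : 0 ≤ Real.logb 2 r := Real.logb_nonneg (by norm_num) (by exact_mod_cast hrpos)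
  have h1 : (45 : ℝ) * n * d ^ 2 ≤ r := by exact_mod_cast hr
  have h2 : (4 : ℝ) * n ≤ r := by exact_mod_cast (by omega : 4 * n ≤ r)
  rw [← mul_div_assoc, div_le_one (by positivity)]
  nlinarith [mul_le_mul_of_nonneg_right h1 (by linarith : (0 : ℝ) ≤ Real.logb 2 r + 1),
    mul_le_mul_of_nonneg_left hL hrpos.le]

/-- error bound for the multivariate squared Fejér kernel. -/
theorem mvCheb1Norm_squared_fejer_error (n d : ℕ) (hn : 1 ≤ n) (hd : 1 ≤ d)
    (r : ℕ) (hr : 45 * n * d ^ 2 ≤ r) (N : ℕ) (hN : N = ⌈3 * Real.logb 2 r⌉₊)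
    (α : Fin n → ℕ) (hα : ∀ i, α i ≤ d)
    (Q : ℕ → Polynomial ℝ)
    (hQ : ∀ k : ℕ, ∀ x : ℝ, (Q k).eval x =
      ∫ y, (chebT k).eval y * (Sker r (fejerWeights r) x y) ^ 2 ∂chebMeasure) :
    mvCheb1Norm
        ((∏ i, Polynomial.aeval (MvPolynomial.X i) (pPoly r (fejerWeights r) N * Q (α i))) -
          mvChebT n α) ≤
      Real.exp 1 * n * (45 * (d : ℝ) ^ 2 * (Real.logb 2 r + 1) + 4) / (r : ℝ) ^ 2 := by
  have hr' : 45 * d ^ 2 ≤ r :=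
    (Nat.mul_le_mul_right _ (Nat.le_mul_of_pos_right 45 hn)).trans hr
  have hr0 : 0 < r := (by positivity : 0 < 45 * d ^ 2).trans_le hr'
  set ε := (45 * (d : ℝ) ^ 2 * (Real.logb 2 r + 1) + 4) / (r : ℝ) ^ 2 with hε
  have hq : ∀ i, AbsComb (Set.range (Polynomial.Chebyshev.T ℝ))
      (pPoly r (fejerWeights r) N * Q (α i) - chebT (α i)) ε := fun i =>
    (Polynomial.Chebyshev.absComb_pPoly_mul_sub hr0 N (hQ (α i))).mono
      (fejer_error_le hd hr' (hα i) hN)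
  refine (mvCheb1Norm_le_of_absComb (absComb_prod_aeval_sub_prod hq)).trans ?_
  rw [mul_div_assoc, ← hε]
  exact one_add_pow_sub_one_le (hq ⟨0, hn⟩).nonneg (natCast_mul_fejer_error_le_one hd hn hr)
end

section
/- Let n ≥ 1 and d ≥ 1 be integers and let f be a real polynomial in n variables x_1,…,x_n of total degree at most d. Let f_min denote the minimum of f over [−1,1]^n. Let r be a positive integer such that n divides r and r/log₂ r ≥ 540·n²·d². Then there exist a real number t, a sum of squares of real polynomials σ_0 of total degree at most 2r, and sums of squares of real polynomials σ_1,…,σ_n of total degree at most 2r−2, such that f − t = σ_0 + ∑_{i=1}^n (1 − x_i²)·σ_i and f_min − t ≤ 70458 · n³ · d² · ‖f‖_{1,cheb} · (log₂ r)³ / r². -/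
open Polynomial

/-- An n-variate real polynomial is a sum of squares if it is a finite sum of squares
of real polynomials. -/
def IsSOS {n : ℕ} (p : MvPolynomial (Fin n) ℝ) : Prop :=
  ∃ (s : ℕ) (h : Fin s → MvPolynomial (Fin n) ℝ), p = ∑ i, (h i) ^ 2

theorem Polynomial.isSumSq_of_eval_nonneg (p : ℝ[X]) (hp : ∀ x, 0 ≤ p.eval x) : IsSumSq p := by
  induction hN : p.natDegree using Nat.strong_induction_on generalizing p with
  | _ N ih =>
  subst hN
  by_cases hp0 : p.natDegree = 0
  · obtain ⟨c, rfl⟩ := Polynomial.natDegree_eq_zero.1 hp0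
    have hc : 0 ≤ c := by simpa using hp 0
    have : (C c : ℝ[X]) = C (√c) * C (√c) := by rw [← C_mul, Real.mul_self_sqrt hc]
    rw [this]
    exact IsSumSq.mul_self _
  have hpne : p ≠ 0 := by rintro rfl; simp at hp0
  -- it suffices to split off a monic quadratic factor which is a sum of squares
  have key : ∀ q : ℝ[X], q.Monic → q.natDegree = 2 → IsSumSq q →
      {x | q.eval x ≤ 0}.Finite → q ∣ p → IsSumSq p := by
    rintro q hqm hq2 hqs hqf ⟨g, rfl⟩
    have hg : ∀ x, 0 ≤ g.eval x := by
      have hd : Dense {x : ℝ | q.eval x ≤ 0}ᶜ := hqf.countable.dense_compl ℝ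
      have hcl : IsClosed {x : ℝ | 0 ≤ g.eval x} := isClosed_le continuous_const g.continuous
      have hsub : {x : ℝ | q.eval x ≤ 0}ᶜ ⊆ {x : ℝ | 0 ≤ g.eval x} := by
        intro x hx
        have hx' : 0 < q.eval x := not_le.1 hx
        have := hp x
        rw [eval_mul] at this
        exact nonneg_of_mul_nonneg_right this hx'
      intro x
      exact hcl.closure_subset_iff.2 hsub (hd x)
    have hg0 : g ≠ 0 := right_ne_zero_of_mul hpne
    refine hqs.mul (ih g.natDegree ?_ g hg rfl)
    rw [hqm.natDegree_mul' hg0]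
    omega
  obtain ⟨z, hz⟩ := Complex.exists_root (f := p.map (algebraMap ℝ ℂ))
    (by rw [degree_map]; exact natDegree_pos_iff_degree_pos.1 (Nat.pos_of_ne_zero hp0))
  have hz' : aeval z p = 0 := by rwa [IsRoot, eval_map_algebraMap] at hz
  have hfact : (X ^ 2 - C (2 * z.re) * X + C (‖z‖ ^ 2) : ℝ[X]) =
      (X - C z.re) * (X - C z.re) + C z.im * C z.im := by
    rw [Complex.sq_norm, Complex.normSq_apply]
    simp only [C_mul, C_add, map_ofNat]
    ring
  by_cases him : z.im = 0
  · have hroot : p.IsRoot z.re := by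
      have : z = (algebraMap ℝ ℂ z.re) := by
        apply Complex.ext <;> simp [him]
      rw [this, aeval_algebraMap_apply] at hz'
      simpa [IsRoot] using hz'
    have hmin : IsLocalMin (fun x => p.eval x) z.re :=
      Filter.Eventually.of_forall fun x => by
        simpa [hroot.eq_zero] using hp x
    have hder : (derivative p).IsRoot z.re := by
      have := hmin.deriv_eq_zero
      rwa [Polynomial.deriv] at this
    have hdvd : (X - C z.re) ^ 2 ∣ p :=
      (le_rootMultiplicity_iff hpne).1 ((one_lt_rootMultiplicity_iff_isRoot hpne).2 ⟨hroot, hder⟩)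
    refine key _ ((monic_X_sub_C _).pow 2) (by simp) ?_ ?_ hdvd
    · rw [sq]
      exact IsSumSq.mul_self _
    · refine (Set.finite_singleton z.re).subset fun x hx => ?_
      have hx' : (x - z.re) ^ 2 ≤ 0 := by simpa using hx
      have := pow_eq_zero_iff (two_ne_zero) |>.1 (le_antisymm hx' (sq_nonneg _))
      simpa [sub_eq_zero] using this
  · have hdvd := p.quadratic_dvd_of_aeval_eq_zero_im_ne_zero hz' him
    have hm : (X ^ 2 - C (2 * z.re) * X + C (‖z‖ ^ 2) : ℝ[X]).natDegree = 2 ∧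
        (X ^ 2 - C (2 * z.re) * X + C (‖z‖ ^ 2) : ℝ[X]).Monic := by
      constructor
      · compute_degree!
      · monicity!
    refine key _ hm.2 hm.1 ?_ ?_ hdvd
    · rw [hfact]
      exact (IsSumSq.mul_self _).add (IsSumSq.mul_self _)
    · rw [hfact]
      convert Set.finite_empty
      ext x
      simp only [eval_add, eval_mul, eval_sub, eval_X, eval_C, Set.mem_ofPred_eq,
        Set.mem_empty_iff_false, iff_false, not_le]
      have := mul_self_pos.2 him
      nlinarith [mul_self_nonneg (x - z.re)]

theorem IsSumSq.isSOS {n : ℕ} {p : MvPolynomial (Fin n) ℝ} (hp : IsSumSq p) : IsSOS p := by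
  induction hp with
  | zero => exact ⟨0, Fin.elim0, by simp⟩
  | sq_add a _ ih =>
    obtain ⟨s, h, rfl⟩ := ih
    exact ⟨s + 1, Fin.cons a h, by simp [Fin.sum_univ_succ, sq]⟩

theorem Polynomial.Chebyshev.T_sq_add_one_sub_X_sq_mul_U_sq (k : ℕ) :
    T ℝ k ^ 2 + (1 - X ^ 2) * U ℝ ((k : ℤ) - 1) ^ 2 = 1 := by
  induction k with
  | zero => simp
  | succ k ih =>
    have h1 := T_eq_X_mul_T_sub_pol_U ℝ ((k : ℤ) - 1)
    have h2 := U_eq_X_mul_U_add_T ℝ ((k : ℤ) - 1)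
    rw [show (k : ℤ) - 1 + 2 = k + 1 by ring, show (k : ℤ) - 1 + 1 = k by ring] at h1
    rw [show (k : ℤ) - 1 + 1 = k by ring] at h2
    push_cast
    rw [add_sub_cancel_right, h1, h2]
    linear_combination ih

theorem IsSumSq.map_ringHom {A B : Type*} [CommSemiring A] [CommSemiring B] (φ : A →+* B) {a : A}
    (ha : IsSumSq a) : IsSumSq (φ a) := by
  induction ha with
  | zero => simp
  | sq_add a _ ih =>
    rw [map_add, map_mul]
    exact (IsSumSq.mul_self _).add ih

/-- Membership in the quadratic module of the hypercube `[-1, 1]ⁿ` truncated at degree `2 * r`. -/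
def MemBoxModule {n : ℕ} (r : ℕ) (p : MvPolynomial (Fin n) ℝ) : Prop :=
  ∃ (σ₀ : MvPolynomial (Fin n) ℝ) (σ : Fin n → MvPolynomial (Fin n) ℝ),
    IsSumSq σ₀ ∧ σ₀.totalDegree ≤ 2 * r ∧
    (∀ i, IsSumSq (σ i) ∧ (σ i).totalDegree ≤ 2 * r - 2) ∧
    p = σ₀ + ∑ i, (1 - (MvPolynomial.X i) ^ 2) * σ i

namespace MemBoxModule

variable {n r : ℕ} {p q : MvPolynomial (Fin n) ℝ}

theorem of_isSumSq (hp : IsSumSq p) (hd : p.totalDegree ≤ 2 * r) : MemBoxModule r p :=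
  ⟨p, 0, hp, hd, fun _ => ⟨.zero, by simp⟩, by simp⟩

theorem add (hp : MemBoxModule r p) (hq : MemBoxModule r q) : MemBoxModule r (p + q) := by
  obtain ⟨σ₀, σ, h1, h2, h3, rfl⟩ := hp
  obtain ⟨τ₀, τ, k1, k2, k3, rfl⟩ := hq
  refine ⟨σ₀ + τ₀, σ + τ, h1.add k1, (MvPolynomial.totalDegree_add _ _).trans (max_le h2 k2),
    fun i => ⟨(h3 i).1.add (k3 i).1,
      (MvPolynomial.totalDegree_add _ _).trans (max_le (h3 i).2 (k3 i).2)⟩, ?_⟩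
  simp only [Pi.add_apply, mul_add, Finset.sum_add_distrib]
  ring

theorem _root_.MvPolynomial.isSumSq_C {c : ℝ} (hc : 0 ≤ c) :
    IsSumSq (MvPolynomial.C c : MvPolynomial (Fin n) ℝ) := by
  rw [← Real.mul_self_sqrt hc, MvPolynomial.C_mul]
  exact .mul_self _

theorem C_mul {c : ℝ} (hc : 0 ≤ c) (hp : MemBoxModule r p) :
    MemBoxModule r (MvPolynomial.C c * p) := by
  obtain ⟨σ₀, σ, h1, h2, h3, rfl⟩ := hp
  have hdeg (s : MvPolynomial (Fin n) ℝ) : (MvPolynomial.C c * s).totalDegree ≤ s.totalDegree :=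
    (MvPolynomial.totalDegree_mul _ _).trans (by simp)
  have hcs : IsSumSq (MvPolynomial.C c : MvPolynomial (Fin n) ℝ) := MvPolynomial.isSumSq_C hc
  refine ⟨MvPolynomial.C c * σ₀, fun i => MvPolynomial.C c * σ i, hcs.mul h1, (hdeg _).trans h2,
    fun i => ⟨hcs.mul (h3 i).1, (hdeg _).trans (h3 i).2⟩, ?_⟩
  rw [mul_add, Finset.mul_sum]
  congr 1
  exact Finset.sum_congr rfl fun i _ => by ring

theorem sum {ι : Type*} (s : Finset ι) {f : ι → MvPolynomial (Fin n) ℝ}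
    (h : ∀ i ∈ s, MemBoxModule r (f i)) : MemBoxModule r (∑ i ∈ s, f i) := by
  classical
  induction s using Finset.induction_on with
  | empty => exact of_isSumSq (by simp) (by simp)
  | insert a s ha ih =>
    rw [Finset.sum_insert ha]
    exact (h a (Finset.mem_insert_self _ _)).add
      (ih fun i hi => h i (Finset.mem_insert_of_mem hi))

end MemBoxModule

theorem totalDegree_aeval_le {n k d : ℕ} {P : ℝ[X]} {g : MvPolynomial (Fin n) ℝ}
    (hP : P.natDegree ≤ k) (hg : g.totalDegree ≤ d) :
    (Polynomial.aeval g P).totalDegree ≤ k * d := by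
  rw [Polynomial.aeval_eq_sum_range]
  refine MvPolynomial.totalDegree_finsetSum_le fun i hi => ?_
  refine (MvPolynomial.totalDegree_smul_le _ _).trans ((MvPolynomial.totalDegree_pow _ _).trans ?_)
  have : i ≤ k := by have := Finset.mem_range.1 hi; omega
  exact Nat.mul_le_mul this hg

theorem totalDegree_aeval_X_le {n : ℕ} (P : ℝ[X]) (i : Fin n) :
    (Polynomial.aeval (MvPolynomial.X i : MvPolynomial (Fin n) ℝ) P).totalDegree ≤ P.natDegree := by
  simpa using totalDegree_aeval_le (g := (MvPolynomial.X i : MvPolynomial (Fin n) ℝ)) le_rfl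
    (MvPolynomial.totalDegree_X (R := ℝ) i).le

theorem natDegree_chebT (k : ℕ) : (chebT k).natDegree = k := by
  simp [chebT, Polynomial.Chebyshev.natDegree_T]

theorem totalDegree_prod_chebT_le {n : ℕ} (α : Fin n → ℕ) (s : Finset (Fin n)) :
    (∏ i ∈ s, Polynomial.aeval (MvPolynomial.X i : MvPolynomial (Fin n) ℝ)
      (chebT (α i))).totalDegree ≤ ∑ i ∈ s, α i := by
  refine (MvPolynomial.totalDegree_finsetProd _ _).trans (Finset.sum_le_sum fun i _ => ?_)
  exact (totalDegree_aeval_X_le _ i).trans (natDegree_chebT _).le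

theorem one_sub_mvChebT_sq {n : ℕ} (α : Fin n → ℕ) :
    1 - mvChebT n α ^ 2 = ∑ i, (1 - MvPolynomial.X i ^ 2) *
      (Polynomial.aeval (MvPolynomial.X i) (Polynomial.Chebyshev.U ℝ ((α i : ℤ) - 1)) *
        ∏ j with j < i, Polynomial.aeval (MvPolynomial.X j) (chebT (α j))) ^ 2 := by
  have key (i : Fin n) : 1 - Polynomial.aeval (MvPolynomial.X i) (chebT (α i)) ^ 2 =
      (1 - MvPolynomial.X i ^ 2) * Polynomial.aeval (MvPolynomial.X i : MvPolynomial (Fin n) ℝ)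
        (Polynomial.Chebyshev.U ℝ ((α i : ℤ) - 1)) ^ 2 := by
    have := congrArg (Polynomial.aeval (MvPolynomial.X i : MvPolynomial (Fin n) ℝ))
      (Polynomial.Chebyshev.T_sq_add_one_sub_X_sq_mul_U_sq (α i))
    simp only [map_add, map_mul, map_sub, map_pow, map_one, Polynomial.aeval_X] at this
    rw [chebT]
    linear_combination -this
  have := Finset.prod_one_sub_ordered (Finset.univ : Finset (Fin n))
    fun i => 1 - Polynomial.aeval (MvPolynomial.X i : MvPolynomial (Fin n) ℝ) (chebT (α i)) ^ 2
  simp only [sub_sub_cancel, Finset.prod_pow] at this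
  rw [mvChebT, this, sub_sub_cancel]
  refine Finset.sum_congr rfl fun i _ => ?_
  rw [key]
  ring

theorem memBoxModule_one_add_mul_mvChebT {n r : ℕ} (α : Fin n → ℕ) (hα : ∑ i, α i ≤ r) {e : ℝ}
    (he : e ^ 2 = 1) : MemBoxModule r (1 + MvPolynomial.C e * mvChebT n α) := by
  set A := mvChebT n α with hA
  have hC : (MvPolynomial.C e : MvPolynomial (Fin n) ℝ) ^ 2 = 1 := by rw [← map_pow, he, map_one]
  have hdegA : A.totalDegree ≤ r := (totalDegree_prod_chebT_le α _).trans hα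
  have h1 : MemBoxModule r ((1 + MvPolynomial.C e * A) * (1 + MvPolynomial.C e * A)) := by
    refine .of_isSumSq (.mul_self _) ((MvPolynomial.totalDegree_mul _ _).trans ?_)
    have : (1 + MvPolynomial.C e * A).totalDegree ≤ r := by
      refine (MvPolynomial.totalDegree_add _ _).trans (max_le (by simp) ?_)
      exact (MvPolynomial.totalDegree_mul _ _).trans (by simpa using hdegA)
    omega
  have h2 : MemBoxModule r (1 - A ^ 2) := by
    refine ⟨0, _, .zero, by simp, fun i => ⟨?_, ?_⟩, by rw [one_sub_mvChebT_sq, zero_add]⟩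
    · rw [sq]
      exact .mul_self _
    · rcases Nat.eq_zero_or_pos (α i) with h0 | hpos
      · simp [h0]
      · have hU : (Polynomial.Chebyshev.U ℝ ((α i : ℤ) - 1)).natDegree = α i - 1 := by
          obtain ⟨k, hk⟩ := Nat.exists_eq_add_of_lt hpos
          rw [hk]
          simp
        have hsum : α i + ∑ j with j < i, α j ≤ ∑ j, α j := by
          rw [← Finset.sum_insert (by simp)]
          exact Finset.sum_le_sum_of_subset (Finset.subset_univ _)
        have hdeg := (MvPolynomial.totalDegree_mul _ _).trans (add_le_add
          ((totalDegree_aeval_X_le (Polynomial.Chebyshev.U ℝ ((α i : ℤ) - 1)) i).trans hU.le)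
          (totalDegree_prod_chebT_le α (Finset.univ.filter (· < i))))
        refine (MvPolynomial.totalDegree_pow _ _).trans ?_
        have := Nat.mul_le_mul_left 2 hdeg
        omega
  have h3 := (h1.add h2).C_mul (c := 1 / 2) (by norm_num)
  convert h3 using 1
  have h4 : (MvPolynomial.C (1 / 2) : MvPolynomial (Fin n) ℝ) * 2 = 1 := by
    rw [← map_ofNat MvPolynomial.C 2, ← MvPolynomial.C_mul]; norm_num
  linear_combination (-1 - MvPolynomial.C e * A) * h4 - MvPolynomial.C (1 / 2) * A ^ 2 * hC

theorem memBoxModule_C_mul_mvChebT_add {n r : ℕ} (α : Fin n → ℕ) (hα : ∑ i, α i ≤ r) (c : ℝ) :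
    MemBoxModule r (MvPolynomial.C c * mvChebT n α + MvPolynomial.C |c|) := by
  rcases abs_cases c with ⟨h, h'⟩ | ⟨h, h'⟩
  · convert (memBoxModule_one_add_mul_mvChebT α hα (e := 1) (by norm_num)).C_mul h' using 1
    rw [h, map_one]
    ring
  · convert (memBoxModule_one_add_mul_mvChebT α hα (e := -1) (by norm_num)).C_mul
      (neg_nonneg.2 h'.le) using 1
    rw [h]
    simp only [map_neg, map_one]
    ring

theorem chebT_zero : chebT 0 = 1 := by simp [chebT]

theorem chebT_one : chebT 1 = X := by simp [chebT]

theorem X_mul_chebT_succ (k : ℕ) : X * chebT (k + 1) = C (1 / 2) * (chebT (k + 2) + chebT k) := by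
  have h := Polynomial.Chebyshev.T_add_two ℝ (k : ℤ)
  have h2 : (C (1 / 2) : ℝ[X]) * 2 = 1 := by
    rw [← map_ofNat C 2, ← C_mul]; norm_num
  simp only [chebT]
  push_cast
  rw [h]
  linear_combination (-X * Polynomial.Chebyshev.T ℝ (k + 1)) * h2

theorem mvChebT_eq_mul_prod_erase {n : ℕ} (α : Fin n → ℕ) (i : Fin n) (k : ℕ) :
    mvChebT n (Function.update α i k) = Polynomial.aeval (MvPolynomial.X i) (chebT k) *
      ∏ j ∈ Finset.univ.erase i, Polynomial.aeval (MvPolynomial.X j) (chebT (α j)) := by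
  rw [mvChebT, ← Finset.mul_prod_erase _ _ (Finset.mem_univ i), Function.update_self]
  congr 1
  refine Finset.prod_congr rfl fun j hj => ?_
  rw [Function.update_of_ne (Finset.ne_of_mem_erase hj)]

theorem eval_mvChebT {n : ℕ} (α : Fin n → ℕ) (x : Fin n → ℝ) :
    MvPolynomial.eval x (mvChebT n α) = ∏ i, (Polynomial.Chebyshev.T ℝ (α i)).eval (x i) := by
  rw [mvChebT, map_prod]
  refine Finset.prod_congr rfl fun i _ => ?_
  have := Polynomial.aeval_algHom_apply (MvPolynomial.aeval x) (MvPolynomial.X i : MvPolynomial (Fin n) ℝ)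
    (chebT (α i))
  rw [MvPolynomial.aeval_X] at this
  rw [← MvPolynomial.coe_aeval_eq_eval, RingHom.coe_coe, ← this, Polynomial.coe_aeval_eq_eval, chebT]

/-- The span of the tensor Chebyshev polynomials of total degree at most `D`. -/
noncomputable def chebSpan (n D : ℕ) : Submodule ℝ (MvPolynomial (Fin n) ℝ) :=
  Submodule.span ℝ (mvChebT n '' {α | ∑ i, α i ≤ D})

theorem chebSpan_mono (n : ℕ) : Monotone (chebSpan n) := fun _ _ h =>
  Submodule.span_mono (Set.image_mono fun _ hα => le_trans hα h)

theorem mvChebT_mem_chebSpan {n D : ℕ} {α : Fin n → ℕ} (h : ∑ i, α i ≤ D) :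
    mvChebT n α ∈ chebSpan n D :=
  Submodule.subset_span ⟨α, h, rfl⟩

theorem X_mul_mem_chebSpan {n D : ℕ} (i : Fin n) {p : MvPolynomial (Fin n) ℝ}
    (hp : p ∈ chebSpan n D) : MvPolynomial.X i * p ∈ chebSpan n (D + 1) := by
  induction hp using Submodule.span_induction with
  | zero => simp
  | add p q _ _ hp hq => rw [mul_add]; exact add_mem hp hq
  | smul a p _ hp => rw [mul_smul_comm]; exact Submodule.smul_mem _ a hp
  | mem p hp =>
    obtain ⟨α, hα, rfl⟩ := hp
    have hα' : ∑ j, α j ≤ D := hα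
    have hsum (k : ℕ) (hk : k ≤ α i + 1) : ∑ j, Function.update α i k j ≤ D + 1 := by
      rw [Finset.sum_update_of_mem (Finset.mem_univ i), ← Finset.erase_eq]
      rw [← Finset.add_sum_erase _ _ (Finset.mem_univ i)] at hα'
      omega
    have hupd := mvChebT_eq_mul_prod_erase α i (α i)
    rw [Function.update_eq_self] at hupd
    rw [hupd, ← mul_assoc]
    have hX (P : ℝ[X]) : MvPolynomial.X i * Polynomial.aeval (MvPolynomial.X i) P =
        Polynomial.aeval (MvPolynomial.X i : MvPolynomial (Fin n) ℝ) (X * P) := by simp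
    rw [hX]
    rcases h : α i with _ | k
    · rw [chebT_zero, mul_one, ← chebT_one, ← mvChebT_eq_mul_prod_erase]
      exact mvChebT_mem_chebSpan (hsum _ (by omega))
    · rw [X_mul_chebT_succ, ← smul_eq_C_mul, map_smul, map_add, smul_mul_assoc, add_mul,
        ← mvChebT_eq_mul_prod_erase, ← mvChebT_eq_mul_prod_erase]
      exact Submodule.smul_mem _ _ (add_mem (mvChebT_mem_chebSpan (hsum _ (by omega)))
        (mvChebT_mem_chebSpan (hsum _ (by omega))))

theorem monomial_one_mem_chebSpan {n : ℕ} (D : ℕ) (s : Fin n →₀ ℕ) (hs : s.degree = D) :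
    MvPolynomial.monomial s (1 : ℝ) ∈ chebSpan n D := by
  induction D generalizing s with
  | zero =>
    obtain rfl : s = 0 := (Finsupp.degree_eq_zero_iff s).1 hs
    convert mvChebT_mem_chebSpan (n := n) (α := 0) (D := 0) (by simp)
    simp [mvChebT, chebT_zero]
  | succ D ih =>
    obtain ⟨i, hi⟩ : ∃ i, s i ≠ 0 := by
      by_contra! h
      have : s = 0 := Finsupp.ext h
      simp [this] at hs
    have hle : Finsupp.single i 1 ≤ s := Finsupp.single_le_iff.2 (Nat.one_le_iff_ne_zero.2 hi)
    have hsplit : s = Finsupp.single i 1 + (s - Finsupp.single i 1) :=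
      (add_tsub_cancel_of_le hle).symm
    have hdeg : (s - Finsupp.single i 1).degree = D := by
      have := congrArg Finsupp.degree hsplit
      rw [map_add, Finsupp.degree_single] at this
      omega
    rw [hsplit, ← mul_one (1 : ℝ), ← MvPolynomial.monomial_mul]
    exact X_mul_mem_chebSpan i (ih _ hdeg)

theorem mem_chebSpan_of_totalDegree_le {n D : ℕ} {p : MvPolynomial (Fin n) ℝ}
    (hp : p.totalDegree ≤ D) : p ∈ chebSpan n D := by
  rw [p.as_sum]
  refine Submodule.sum_mem _ fun s hs => ?_
  rw [← mul_one (p.coeff s), ← smul_eq_mul, ← MvPolynomial.smul_monomial]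
  refine Submodule.smul_mem _ _ (chebSpan_mono n ?_ (monomial_one_mem_chebSpan _ s rfl))
  refine le_trans ?_ ((MvPolynomial.le_totalDegree hs).trans hp)
  rw [Finsupp.degree_eq_sum, Finsupp.sum_fintype _ _ (by simp)]

theorem exists_chebyshev_expansion {n D : ℕ} {p : MvPolynomial (Fin n) ℝ}
    (hp : p.totalDegree ≤ D) : ∃ c : (Fin n → ℕ) →₀ ℝ, (∀ α ∈ c.support, ∑ i, α i ≤ D) ∧
      p = c.sum fun α coef => MvPolynomial.C coef * mvChebT n α := by
  obtain ⟨c, hc, rfl⟩ := (Finsupp.mem_span_image_iff_linearCombination ℝ).1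
    (mem_chebSpan_of_totalDegree_le hp)
  refine ⟨c, fun α hα => (Finsupp.mem_supported ℝ c).1 hc hα, ?_⟩
  rw [Finsupp.linearCombination_apply]
  simp only [MvPolynomial.smul_eq_C_mul]

theorem abs_eval_mvChebT_le_one {n : ℕ} (α : Fin n → ℕ) {x : Fin n → ℝ}
    (hx : ∀ i, x i ∈ Set.Icc (-1 : ℝ) 1) : |MvPolynomial.eval x (mvChebT n α)| ≤ 1 := by
  rw [eval_mvChebT, Finset.abs_prod]
  exact Finset.prod_le_one (fun _ _ => abs_nonneg _) fun i _ =>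
    Polynomial.Chebyshev.abs_eval_T_real_le_one _ (abs_le.2 (hx i))

theorem abs_eval_le_mvCheb1Norm {n : ℕ} (p : MvPolynomial (Fin n) ℝ) {x : Fin n → ℝ}
    (hx : ∀ i, x i ∈ Set.Icc (-1 : ℝ) 1) : |MvPolynomial.eval x p| ≤ mvCheb1Norm p := by
  refine le_csInf ?_ ?_
  · obtain ⟨c, -, hc⟩ := exists_chebyshev_expansion (p := p) le_rfl
    exact ⟨_, c, hc, rfl⟩
  · rintro s ⟨c, rfl, rfl⟩
    rw [Finsupp.sum, map_sum]
    refine (Finset.abs_sum_le_sum_abs _ _).trans (Finset.sum_le_sum fun α _ => ?_)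
    rw [map_mul, MvPolynomial.eval_C, abs_mul]
    exact mul_le_of_le_one_right (abs_nonneg _) (abs_eval_mvChebT_le_one α hx)

section Orthogonality

open MeasureTheory Polynomial.Chebyshev

instance isFiniteMeasure_measureT : IsFiniteMeasure measureT := by
  have h := integrable_measureT (f := fun _ => (1 : ℝ)) continuousOn_const
  exact (integrable_const_iff_isFiniteMeasure one_ne_zero).1 h

theorem measureT_real_univ : measureT.real Set.univ = Real.pi := by
  have := integral_eval_T_real_measureT_zero
  simpa using this

theorem ae_measureT_mem_Icc : ∀ᵐ x ∂measureT, x ∈ Set.Icc (-1 : ℝ) 1 := by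
  rw [measureT]
  filter_upwards [ae_restrict_mem measurableSet_Ioc] with x hx using Set.Ioc_subset_Icc_self hx

theorem integrable_eval_mvChebT_mul {n : ℕ} (α β : Fin n → ℕ) :
    Integrable (fun x => MvPolynomial.eval x (mvChebT n α) * MvPolynomial.eval x (mvChebT n β))
      (Measure.pi fun _ : Fin n => measureT) := by
  simp only [eval_mvChebT, ← Finset.prod_mul_distrib]
  exact Integrable.fintype_prod
    (f := fun i y => (T ℝ (α i)).eval y * (T ℝ (β i)).eval y)
    fun i => integrable_measureT (by fun_prop)

theorem integral_eval_mvChebT_mul_of_ne {n : ℕ} {α β : Fin n → ℕ} (h : α ≠ β) :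
    ∫ x, MvPolynomial.eval x (mvChebT n α) * MvPolynomial.eval x (mvChebT n β)
      ∂(Measure.pi fun _ : Fin n => measureT) = 0 := by
  simp only [eval_mvChebT, ← Finset.prod_mul_distrib]
  rw [integral_fintype_prod_eq_prod (fun i y => (T ℝ (α i)).eval y * (T ℝ (β i)).eval y)]
  obtain ⟨i, hi⟩ := Function.ne_iff.1 h
  exact Finset.prod_eq_zero (Finset.mem_univ i)
    (integral_eval_T_real_mul_eval_T_real_measureT_of_ne hi)

theorem le_integral_eval_mvChebT_mul_self {n : ℕ} (α : Fin n → ℕ) :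
    (Real.pi / 2) ^ n ≤ ∫ x, MvPolynomial.eval x (mvChebT n α) * MvPolynomial.eval x (mvChebT n α)
      ∂(Measure.pi fun _ : Fin n => measureT) := by
  simp only [eval_mvChebT, ← Finset.prod_mul_distrib]
  rw [integral_fintype_prod_eq_prod (fun i y => (T ℝ (α i)).eval y * (T ℝ (α i)).eval y)]
  have : (Real.pi / 2) ^ n = ∏ _i : Fin n, (Real.pi / 2) := by
    rw [Finset.prod_const, Finset.card_univ, Fintype.card_fin]
  rw [this]
  refine Finset.prod_le_prod (fun _ _ => by positivity) fun i _ => ?_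
  rcases eq_or_ne (α i) 0 with h | h
  · rw [h]
    have := integral_eval_T_real_mul_self_measureT_zero
    push_cast
    rw [this]
    linarith [Real.pi_pos]
  · exact (integral_T_real_mul_self_measureT_of_ne_zero h).ge

/-- Chebyshev coefficients are controlled by the supremum norm on the hypercube. -/
theorem abs_coeff_le_of_abs_eval_le {n : ℕ} {p : MvPolynomial (Fin n) ℝ} {c : (Fin n → ℕ) →₀ ℝ}
    (hc : p = c.sum fun α coef => MvPolynomial.C coef * mvChebT n α) {δ : ℝ}
    (hp : ∀ x : Fin n → ℝ, (∀ i, x i ∈ Set.Icc (-1 : ℝ) 1) → |MvPolynomial.eval x p| ≤ δ)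
    (α : Fin n → ℕ) : |c α| ≤ 2 ^ n * δ := by
  set μ := Measure.pi fun _ : Fin n => measureT with hμ
  have hint : ∫ x, MvPolynomial.eval x p * MvPolynomial.eval x (mvChebT n α) ∂μ =
      c α * ∫ x, MvPolynomial.eval x (mvChebT n α) * MvPolynomial.eval x (mvChebT n α) ∂μ := by
    have (x : Fin n → ℝ) : MvPolynomial.eval x p * MvPolynomial.eval x (mvChebT n α) =
        ∑ β ∈ c.support, c β *
          (MvPolynomial.eval x (mvChebT n β) * MvPolynomial.eval x (mvChebT n α)) := by
      rw [hc, Finsupp.sum, map_sum, Finset.sum_mul]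
      refine Finset.sum_congr rfl fun β _ => ?_
      rw [map_mul, MvPolynomial.eval_C, mul_assoc]
    simp only [this]
    rw [integral_finsetSum _ fun β _ => (integrable_eval_mvChebT_mul β α).const_mul _]
    simp only [integral_const_mul]
    refine Finset.sum_eq_single α (fun β _ hβ => ?_) fun hα => ?_
    · rw [integral_eval_mvChebT_mul_of_ne hβ, mul_zero]
    · rw [Finsupp.notMem_support_iff.1 hα, zero_mul]
  have hbound : |∫ x, MvPolynomial.eval x p * MvPolynomial.eval x (mvChebT n α) ∂μ| ≤
      δ * Real.pi ^ n := by
    have hae : ∀ᵐ x ∂μ, ∀ i, x i ∈ Set.Icc (-1 : ℝ) 1 :=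
      ae_all_iff.2 fun i => (Measure.tendsto_eval_ae_ae (μ := fun _ : Fin n => measureT)
        (i := i)).eventually ae_measureT_mem_Icc
    have h := norm_integral_le_of_norm_le_const (μ := μ) (C := δ)
      (f := fun x => MvPolynomial.eval x p * MvPolynomial.eval x (mvChebT n α)) (by
        filter_upwards [hae] with x hx
        rw [Real.norm_eq_abs, abs_mul]
        exact (mul_le_of_le_one_right (abs_nonneg _) (abs_eval_mvChebT_le_one α hx)).trans
          (hp x hx))
    have hmass : μ.real Set.univ = Real.pi ^ n := by
      rw [Measure.real, hμ, Measure.pi_univ, ENNReal.toReal_prod]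
      rw [Finset.prod_const, Finset.card_univ, Fintype.card_fin, ← measureT_real_univ, Measure.real]
    rwa [hmass, Real.norm_eq_abs] at h
  rw [hint, abs_mul] at hbound
  have hself := le_integral_eval_mvChebT_mul_self α
  have h1 : |c α| * (Real.pi / 2) ^ n ≤ δ * Real.pi ^ n :=
    (mul_le_mul_of_nonneg_left (hself.trans (le_abs_self _)) (abs_nonneg _)).trans hbound
  have hpi : 0 < (Real.pi / 2) ^ n := by positivity
  have h2 : δ * Real.pi ^ n = 2 ^ n * δ * (Real.pi / 2) ^ n := by
    rw [mul_right_comm, ← mul_pow, mul_div_cancel₀ _ two_ne_zero, mul_comm]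
  exact le_of_mul_le_mul_right (h1.trans_eq h2) hpi

end Orthogonality

theorem memBoxModule_add_C_of_abs_eval_le {n r : ℕ} {p : MvPolynomial (Fin n) ℝ}
    (hdeg : p.totalDegree ≤ r) {δ : ℝ}
    (hp : ∀ x : Fin n → ℝ, (∀ i, x i ∈ Set.Icc (-1 : ℝ) 1) → |MvPolynomial.eval x p| ≤ δ) :
    MemBoxModule r (p + MvPolynomial.C ((2 * (r + 1)) ^ n * δ)) := by
  obtain ⟨c, hcs, hc⟩ := exists_chebyshev_expansion hdeg
  have hδ : 0 ≤ δ := (abs_nonneg _).trans (hp 0 fun _ => by simp)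
  have hcard : c.support.card ≤ (r + 1) ^ n := by
    have hsub : c.support ⊆ Fintype.piFinset fun _ : Fin n => Finset.range (r + 1) := by
      intro α hα
      rw [Fintype.mem_piFinset]
      intro i
      have := Finset.single_le_sum (f := α) (fun j _ => Nat.zero_le _) (Finset.mem_univ i)
      have := hcs α hα
      rw [Finset.mem_range]
      omega
    simpa using Finset.card_le_card hsub
  have hnorm : ∑ α ∈ c.support, |c α| ≤ (2 * (r + 1)) ^ n * δ := by
    refine (Finset.sum_le_card_nsmul _ _ _ fun α _ => abs_coeff_le_of_abs_eval_le hc hp α).trans ?_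
    rw [nsmul_eq_mul, mul_pow, mul_comm (2 ^ n : ℝ) ((r + 1 : ℝ) ^ n), mul_assoc]
    refine mul_le_mul_of_nonneg_right ?_ (by positivity)
    exact_mod_cast hcard
  have hmain : MemBoxModule r (∑ α ∈ c.support,
      (MvPolynomial.C (c α) * mvChebT n α + MvPolynomial.C |c α|)) :=
    .sum _ fun α hα => memBoxModule_C_mul_mvChebT_add α (hcs α hα) _
  convert hmain.add (.of_isSumSq (MvPolynomial.isSumSq_C (sub_nonneg.2 hnorm))
    (by rw [MvPolynomial.totalDegree_C]; exact Nat.zero_le _)) using 1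
  rw [Finset.sum_add_distrib, hc, Finsupp.sum, map_sub, map_sum]
  ring

/-- The factor `1 - T_m / T_m(a)` turns `a - X` into a polynomial which is nonnegative on `ℝ`. -/
theorem sub_mul_one_sub_T_div_nonneg {m : ℕ} (hm : Odd m) {s : ℝ} (x : ℝ) :
    0 ≤ (Real.cosh s - x) *
      (1 - (Real.cosh (m * s))⁻¹ * (Polynomial.Chebyshev.T ℝ m).eval x) := by
  have hA : 0 < Real.cosh (m * s) := Real.cosh_pos _
  have hfac : 1 - (Real.cosh (m * s))⁻¹ * (Polynomial.Chebyshev.T ℝ m).eval x =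
      (Real.cosh (m * s))⁻¹ * (Real.cosh (m * s) - (Polynomial.Chebyshev.T ℝ m).eval x) := by
    field_simp
  rw [hfac, mul_left_comm]
  refine mul_nonneg (inv_nonneg.2 hA.le) ?_
  have hm' : (0 : ℝ) < m := by exact_mod_cast hm.pos
  rcases le_or_gt 1 x with h1 | h1
  · rw [← Real.cosh_arcosh h1, Polynomial.Chebyshev.T_real_cosh, Int.cast_natCast]
    rcases le_total |Real.arcosh x| |s| with h | h
    · refine mul_nonneg (sub_nonneg.2 (Real.cosh_le_cosh.2 h)) (sub_nonneg.2 ?_)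
      rw [Real.cosh_le_cosh, abs_mul, abs_mul]
      gcongr
    · refine mul_nonneg_of_nonpos_of_nonpos (sub_nonpos.2 (Real.cosh_le_cosh.2 h))
        (sub_nonpos.2 ?_)
      rw [Real.cosh_le_cosh, abs_mul, abs_mul]
      gcongr
  · refine mul_nonneg (by linarith [Real.one_le_cosh s]) (sub_nonneg.2 ?_)
    refine le_trans ?_ (Real.one_le_cosh _)
    rcases le_or_gt (-1) x with h2 | h2
    · exact (abs_le.1 (Polynomial.Chebyshev.abs_eval_T_real_le_one m (abs_le.2 ⟨h2, h1.le⟩))).2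
    · have := Polynomial.Chebyshev.one_le_negOnePow_mul_eval_T_real m h2.le
      rw [Int.negOnePow_odd _ (by exact_mod_cast hm)] at this
      push_cast at this
      linarith

theorem memBoxModule_sub_C {n d r m : ℕ} {f : MvPolynomial (Fin n) ℝ} (hdeg : f.totalDegree ≤ d)
    {fmin N : ℝ} (hN : 0 < N) (hm : Odd m) (hmr : (m + 1) * d ≤ r)
    (hf : ∀ x : Fin n → ℝ, (∀ i, x i ∈ Set.Icc (-1 : ℝ) 1) →
      fmin ≤ MvPolynomial.eval x f ∧ MvPolynomial.eval x f ≤ fmin + 2 * N)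
    {s : ℝ} (hs : Real.cosh s ≤ 2) :
    MemBoxModule r (f - MvPolynomial.C (fmin - N * (Real.cosh s - 1 +
      (2 * (r + 1)) ^ n * (3 * (Real.cosh (m * s))⁻¹)))) := by
  set a := Real.cosh s
  set A := Real.cosh (m * s)
  have ha : 1 ≤ a := Real.one_le_cosh s
  have hA : 0 < A := Real.cosh_pos _
  set g : MvPolynomial (Fin n) ℝ := 1 - MvPolynomial.C N⁻¹ * (f - MvPolynomial.C fmin) with hg
  have hgdeg : g.totalDegree ≤ d := by
    refine (MvPolynomial.totalDegree_sub _ _).trans (max_le (by simp) ?_)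
    refine (MvPolynomial.totalDegree_mul _ _).trans ?_
    rw [MvPolynomial.totalDegree_C, zero_add]
    refine (MvPolynomial.totalDegree_sub _ _).trans (max_le hdeg ?_)
    rw [MvPolynomial.totalDegree_C]
    exact Nat.zero_le _
  have hfg : f - MvPolynomial.C fmin = MvPolynomial.C N * (1 - g) := by
    rw [hg, sub_sub_cancel, ← mul_assoc, ← MvPolynomial.C_mul, mul_inv_cancel₀ hN.ne', map_one,
      one_mul]
  have hgbox (x : Fin n → ℝ) (hx : ∀ i, x i ∈ Set.Icc (-1 : ℝ) 1) :
      |MvPolynomial.eval x g| ≤ 1 := by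
    obtain ⟨h1, h2⟩ := hf x hx
    have : MvPolynomial.eval x g = 1 - N⁻¹ * (MvPolynomial.eval x f - fmin) := by simp [hg]
    rw [this, abs_le]
    have h3 : 0 ≤ N⁻¹ * (MvPolynomial.eval x f - fmin) :=
      mul_nonneg (inv_nonneg.2 hN.le) (sub_nonneg.2 h1)
    have h4 : N⁻¹ * (MvPolynomial.eval x f - fmin) ≤ 2 := by
      rw [inv_mul_le_iff₀ hN]
      linarith
    constructor <;> linarith
  have hTdeg : (Polynomial.Chebyshev.T ℝ m).natDegree ≤ m := by
    simp [Polynomial.Chebyshev.natDegree_T]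
  set P : ℝ[X] := (C a - X) * (1 - C A⁻¹ * Polynomial.Chebyshev.T ℝ m) with hP
  set E : ℝ[X] := (C a - X) * (C A⁻¹ * Polynomial.Chebyshev.T ℝ m) with hE
  have hlin : (C a - X : ℝ[X]).natDegree ≤ 1 := by compute_degree
  have hCT : (C A⁻¹ * Polynomial.Chebyshev.T ℝ m).natDegree ≤ m :=
    (natDegree_C_mul_le _ _).trans hTdeg
  have hPdeg : P.natDegree ≤ m + 1 := by
    refine natDegree_mul_le.trans ?_
    have : (1 - C A⁻¹ * Polynomial.Chebyshev.T ℝ m).natDegree ≤ m :=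
      (natDegree_sub_le _ _).trans (max_le (by simp) hCT)
    omega
  have hEdeg : E.natDegree ≤ m + 1 := by
    refine natDegree_mul_le.trans ?_
    omega
  have hPmem : MemBoxModule r (Polynomial.aeval g P) := by
    have hsq : IsSumSq P := P.isSumSq_of_eval_nonneg fun x => by
      simpa [hP] using sub_mul_one_sub_T_div_nonneg hm (s := s) x
    have := (totalDegree_aeval_le hPdeg hgdeg).trans hmr
    exact .of_isSumSq (hsq.map_ringHom (Polynomial.aeval g).toRingHom) (this.trans (by omega))
  have hEmem : MemBoxModule r (Polynomial.aeval g E +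
      MvPolynomial.C ((2 * (r + 1)) ^ n * (3 * A⁻¹))) := by
    refine memBoxModule_add_C_of_abs_eval_le
      ((totalDegree_aeval_le hEdeg hgdeg).trans hmr) fun x hx => ?_
    have hev : MvPolynomial.eval x (Polynomial.aeval g E) = E.eval (MvPolynomial.eval x g) := by
      have := Polynomial.aeval_algHom_apply (MvPolynomial.aeval x) g E
      rw [← MvPolynomial.coe_aeval_eq_eval, RingHom.coe_coe, ← this,
        Polynomial.coe_aeval_eq_eval]
    have hy := hgbox x hx
    set y := MvPolynomial.eval x g
    have hT := Polynomial.Chebyshev.abs_eval_T_real_le_one m hy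
    rw [hev, hE, eval_mul, eval_mul, eval_sub, eval_C, eval_X, eval_C, abs_mul, abs_mul,
      abs_of_pos (inv_pos.2 hA)]
    have h3 : |a - y| ≤ 3 := by
      rw [abs_le] at hy ⊢
      constructor <;> linarith [hy.1, hy.2]
    exact mul_le_mul h3 (mul_le_of_le_one_right (inv_pos.2 hA).le hT) (by positivity) (by norm_num)
  convert (hPmem.add hEmem).C_mul hN.le using 1
  have hPE : Polynomial.aeval g P + Polynomial.aeval g E = MvPolynomial.C a - g := by
    rw [← map_add, show P + E = C a - X by rw [hP, hE]; ring, map_sub, Polynomial.aeval_C,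
      Polynomial.aeval_X]
    rfl
  rw [← add_assoc, hPE, map_sub, map_mul, map_add, map_sub, map_one]
  linear_combination hfg

theorem exists_degree_and_parameter {n d r : ℕ} (hn : 1 ≤ n) (hd : 1 ≤ d)
    (hr : 540 * (n : ℝ) ^ 2 * (d : ℝ) ^ 2 ≤ (r : ℝ) / Real.logb 2 r) :
    ∃ (m : ℕ) (s : ℝ), Odd m ∧ (m + 1) * d ≤ r ∧ Real.cosh s ≤ 2 ∧
      Real.cosh s - 1 + (2 * (r + 1)) ^ n * (3 * (Real.cosh (m * s))⁻¹) ≤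
        70458 * (n : ℝ) ^ 3 * (d : ℝ) ^ 2 * (Real.logb 2 r) ^ 3 / (r : ℝ) ^ 2 := by
  have hn' : (1 : ℝ) ≤ n := by exact_mod_cast hn
  have hd' : (1 : ℝ) ≤ d := by exact_mod_cast hd
  have hr2 : 2 ≤ r := by
    by_contra! h
    have : (r : ℝ) / Real.logb 2 r = 0 := by interval_cases r <;> simp
    rw [this] at hr
    have : 0 < 540 * (n : ℝ) ^ 2 * (d : ℝ) ^ 2 := by positivity
    linarith
  have hr2' : (2 : ℝ) ≤ r := by exact_mod_cast hr2
  have hrpos : (0 : ℝ) < r := by linarith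
  set L := Real.logb 2 r with hL
  have hL1 : 1 ≤ L := by
    rw [hL, Real.le_logb_iff_rpow_le one_lt_two hrpos]
    simpa using hr2'
  have hLlog : Real.log r ≤ L := by
    rw [hL, Real.logb, le_div_iff₀ (Real.log_pos one_lt_two)]
    refine mul_le_of_le_one_right (Real.log_nonneg (by linarith)) ?_
    linarith [Real.log_two_lt_d9]
  have hr' : 540 * (n : ℝ) ^ 2 * (d : ℝ) ^ 2 * L ≤ r := by
    rwa [le_div_iff₀ (by linarith)] at hr
  have hndL : 540 * ((n : ℝ) * d * L) ≤ r := by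
    refine le_trans ?_ hr'
    have h1 : (n : ℝ) ≤ n ^ 2 := le_self_pow₀ hn' two_ne_zero
    have h2 : (d : ℝ) ≤ d ^ 2 := le_self_pow₀ hd' two_ne_zero
    rw [← mul_assoc, ← mul_assoc]
    gcongr
  have h540d : 540 * (d : ℝ) ≤ r := by
    refine le_trans ?_ hndL
    gcongr
    calc (d : ℝ) = 1 * d * 1 := by ring
      _ ≤ n * d * L := by gcongr
  have h540 : (540 : ℝ) ≤ r := by linarith
  set k := r / (2 * d) with hk
  have hkr : 2 * d * k ≤ r := Nat.mul_div_le _ _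
  have hrk : (r : ℝ) < 2 * d * (k + 1) := by
    exact_mod_cast Nat.lt_mul_div_succ r (show 0 < 2 * d by omega)
  have hk1 : 1 ≤ k := by
    rw [hk, Nat.le_div_iff_mul_le (by omega)]
    have : 540 * d ≤ r := by exact_mod_cast h540d
    omega
  have hm1 : 2 * k - 1 + 1 = 2 * k := by omega
  have hmcast : ((2 * k - 1 : ℕ) : ℝ) = 2 * k - 1 := by
    rw [Nat.cast_sub (by omega)]; push_cast; ring
  set s := 12 * (n * d * L) / r with hs
  have hs0 : 0 ≤ s := by positivity
  have hs1 : s ≤ 1 / 2 := by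
    rw [hs, div_le_iff₀ hrpos]
    linarith
  have hcosh : Real.cosh s - 1 ≤ s ^ 2 := by
    have h1 := Real.cosh_le_exp_half_sq s
    have h2 := (abs_le.1 (Real.abs_exp_sub_one_le (x := s ^ 2 / 2)
      (by rw [abs_of_nonneg (by positivity)]; nlinarith))).2
    rw [abs_of_nonneg (by positivity)] at h2
    linarith
  have hms : 6 * n * Real.log r ≤ (2 * k - 1 : ℕ) * s := by
    have h1 : r / (2 * d) ≤ (2 * k - 1 : ℝ) := by
      rw [div_le_iff₀ (by positivity)]
      nlinarith
    calc 6 * n * Real.log r ≤ 6 * n * L := by gcongr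
      _ = r / (2 * d) * s := by rw [hs]; field_simp; norm_num
      _ ≤ _ := by rw [hmcast]; gcongr
  have hA : (r : ℝ) ^ (6 * n) ≤ 2 * Real.cosh ((2 * k - 1 : ℕ) * s) := by
    have h1 : (r : ℝ) ^ (6 * n) = Real.exp (6 * n * Real.log r) := by
      rw [← Real.exp_log hrpos, ← Real.exp_nat_mul, Real.log_exp]
      push_cast
      ring_nf
    rw [h1, Real.cosh_eq]
    linarith [Real.exp_le_exp.2 hms, Real.exp_pos (-((2 * k - 1 : ℕ) * s))]
  have herr : (2 * (r + 1 : ℝ)) ^ n * (3 * (Real.cosh ((2 * k - 1 : ℕ) * s))⁻¹) ≤ 1 / r ^ 2 := by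
    have h1 : (2 * (r + 1 : ℝ)) ^ n ≤ r ^ (2 * n) := by
      rw [pow_mul]
      gcongr
      nlinarith
    rw [← mul_assoc, ← div_eq_mul_inv, div_le_div_iff₀ (Real.cosh_pos _) (by positivity), one_mul]
    have h2 : (r : ℝ) ^ (2 * n) * 6 * r ^ 2 ≤ r ^ (6 * n) := by
      calc (r : ℝ) ^ (2 * n) * 6 * r ^ 2 ≤ (r : ℝ) ^ (2 * n) * r * r ^ 2 := by gcongr; linarith
        _ = (r : ℝ) ^ (2 * n + 3) := by ring
        _ ≤ (r : ℝ) ^ (6 * n) := pow_le_pow_right₀ (by linarith) (by omega)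
    have h3 : (2 * (r + 1 : ℝ)) ^ n * 6 * r ^ 2 ≤ r ^ (2 * n) * 6 * r ^ 2 := by gcongr
    linarith
  refine ⟨2 * k - 1, s, ⟨k - 1, by omega⟩, ?_, ?_, ?_⟩
  · rw [hm1]
    linarith
  · nlinarith
  · refine (add_le_add hcosh herr).trans ?_
    rw [hs, div_pow, ← add_div]
    gcongr
    have h1 : (n * d * L) ^ 2 ≤ (n : ℝ) ^ 3 * d ^ 2 * L ^ 3 := by
      rw [mul_pow, mul_pow]
      gcongr <;> norm_num
    have h2 : 1 ≤ (n : ℝ) ^ 3 * d ^ 2 * L ^ 3 :=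
      one_le_mul_of_one_le_of_one_le (one_le_mul_of_one_le_of_one_le (one_le_pow₀ hn')
        (one_le_pow₀ hd')) (one_le_pow₀ hL1)
    nlinarith

/-- improved convergence rate for the Lasserre hierarchy of lower bounds
on the hypercube. -/
theorem lasserre_lower_bound_rate (n d : ℕ) (hn : 1 ≤ n) (hd : 1 ≤ d)
    (f : MvPolynomial (Fin n) ℝ) (hdeg : f.totalDegree ≤ d)
    (fmin : ℝ)
    (hfmin : IsLeast {y : ℝ | ∃ x : Fin n → ℝ,
      (∀ i, x i ∈ Set.Icc (-1 : ℝ) 1) ∧ y = MvPolynomial.eval x f} fmin)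
    (r : ℕ) (hrpos : 0 < r) (hdvd : n ∣ r)
    (hr : 540 * (n : ℝ) ^ 2 * (d : ℝ) ^ 2 ≤ (r : ℝ) / Real.logb 2 r) :
    ∃ (t : ℝ) (σ₀ : MvPolynomial (Fin n) ℝ) (σ : Fin n → MvPolynomial (Fin n) ℝ),
      IsSOS σ₀ ∧ σ₀.totalDegree ≤ 2 * r ∧
      (∀ i, IsSOS (σ i) ∧ (σ i).totalDegree ≤ 2 * r - 2) ∧
      f - MvPolynomial.C t =
        σ₀ + ∑ i, (1 - (MvPolynomial.X i) ^ 2) * σ i ∧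
      fmin - t ≤
        70458 * (n : ℝ) ^ 3 * (d : ℝ) ^ 2 * mvCheb1Norm f *
          (Real.logb 2 r) ^ 3 / (r : ℝ) ^ 2 := by
  have hfm (x : Fin n → ℝ) (hx : ∀ i, x i ∈ Set.Icc (-1 : ℝ) 1) : fmin ≤ MvPolynomial.eval x f :=
    hfmin.2 ⟨x, hx, rfl⟩
  have hfN (x : Fin n → ℝ) (hx : ∀ i, x i ∈ Set.Icc (-1 : ℝ) 1) :=
    abs_eval_le_mvCheb1Norm f hx
  obtain ⟨x₀, hx₀, hfx₀⟩ := hfmin.1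
  have hN0 : 0 ≤ mvCheb1Norm f := (abs_nonneg _).trans (hfN x₀ hx₀)
  rcases hN0.eq_or_lt with hN | hN
  · have hf0 : f = 0 := by
      refine MvPolynomial.funext_set (fun _ => Set.Icc (-1 : ℝ) 1)
        (fun _ => Set.Icc_infinite (by norm_num)) fun x hx => ?_
      have := hfN x fun i => hx i (Set.mem_univ i)
      rw [← hN] at this
      rw [abs_nonpos_iff.1 this, map_zero]
    subst hf0
    refine ⟨0, 0, 0, IsSumSq.zero.isSOS, by simp, fun i => ⟨IsSumSq.zero.isSOS, by simp⟩,
      by simp, ?_⟩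
    rw [hfx₀, ← hN]
    simp
  · obtain ⟨m, s, hm, hmr, hs, hbound⟩ := exists_degree_and_parameter hn hd hr
    obtain ⟨σ₀, σ, h1, h2, h3, h4⟩ := memBoxModule_sub_C hdeg hN hm hmr (fmin := fmin)
      (fun x hx => ⟨hfm x hx, by
        have hx' := (abs_le.1 (hfN x hx)).2
        have hx₀' := (abs_le.1 (hfN x₀ hx₀)).1
        rw [hfx₀]
        linarith⟩) hs
    refine ⟨_, σ₀, σ, h1.isSOS, h2, fun i => ⟨(h3 i).1.isSOS, (h3 i).2⟩, h4, ?_⟩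
    rw [sub_sub_cancel]
    refine (mul_le_mul_of_nonneg_left hbound hN.le).trans_eq ?_
    ring
end
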